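/- arXiv:2504.14673 — 2 statements merged into one kernel-verified Lean document; each statement's English description precedes it below -/
import Mathlib

section
/- For every positive integer r and p,q ≥ 1, GW^{(r)}_{p,q} is a pseudo-distance on the collection of compact metric measure spaces: (1) GW^{(r)}_{p,q}(𝕏,𝕏) = 0 for every 𝕏; (2) GW^{(r)}_{p,q}(𝕏,𝕐) ≥ 0 for all 𝕏,𝕐; (3) GW^{(r)}_{p,q}(𝕏,𝕐) = GW^{(r)}_{p,q}(𝕐,𝕏) for all 𝕏,𝕐; (4) GW^{(r)}_{p,q}(𝕏,ℤ) ≤ GW^{(r)}_{p,q}(𝕏,𝕐) + GW^{(r)}_{p,q}(𝕐,ℤ) for all 𝕏,𝕐,ℤ. -/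
open MeasureTheory Metric Filter Set

namespace GWSOS

variable {X Y : Type*}

/-- The set of couplings of `μ` and `ν`. -/
def Couplings [MeasurableSpace X] [MeasurableSpace Y] (μ : Measure X) (ν : Measure Y) :
    Set (Measure (X × Y)) :=
  {π | IsProbabilityMeasure π ∧ π.map Prod.fst = μ ∧ π.map Prod.snd = ν}

/-- The Gromov–Wasserstein value for cost `c`. -/
noncomputable def gwVal [MeasurableSpace X] [MeasurableSpace Y]
    (c : X × Y → X × Y → ℝ) (μ : Measure X) (ν : Measure Y) : ℝ :=
  ⨅ π : Couplings μ ν,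
    ∫ z, c z.1 z.2 ∂((π : Measure (X × Y)).prod (π : Measure (X × Y)))

/-- (Sym): invariance under permutation of the `2r` coordinate pairs. -/
def SymCond [MeasurableSpace X] [MeasurableSpace Y] (r : ℕ)
    (P : Measure (Fin (2 * r) → X × Y)) : Prop :=
  ∀ σ : Equiv.Perm (Fin (2 * r)), P.map (fun z => z ∘ σ) = P

/-- (Mar): marginal conditions. -/
def MarCond [MeasurableSpace X] [MeasurableSpace Y] (r : ℕ)
    (μ : Measure X) (ν : Measure Y) (P : Measure (Fin (2 * r) → X × Y)) : Prop :=
  ∀ i : Fin (2 * r),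
    P.map (fun z => ((z i).1, fun j : {j : Fin (2 * r) // j ≠ i} => z j.1))
      = μ.prod (P.map (fun z (j : {j : Fin (2 * r) // j ≠ i}) => z j.1)) ∧
    P.map (fun z => ((z i).2, fun j : {j : Fin (2 * r) // j ≠ i} => z j.1))
      = ν.prod (P.map (fun z (j : {j : Fin (2 * r) // j ≠ i}) => z j.1))

/-- (PSD+): the positive semidefiniteness condition. -/
def PSDCond [MeasurableSpace X] [MeasurableSpace Y] (r : ℕ)
    (P : Measure (Fin (2 * r) → X × Y)) : Prop :=
  ∀ (t : ℕ) (ht : t ≤ r) (f : (Fin t → X × Y) → ℝ) (g : (Fin (2 * r - 2 * t) → X × Y) → ℝ),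
    Measurable f → (∃ M, ∀ w, |f w| ≤ M) →
    Measurable g → (∃ M, ∀ w, |g w| ≤ M) → (∀ w, 0 ≤ g w) →
    0 ≤ ∫ z, (f fun s => z ⟨s.1, by have := s.isLt; omega⟩)
          * (f fun s => z ⟨t + s.1, by have := s.isLt; omega⟩)
          * (g fun s => z ⟨2 * t + s.1, by have := s.isLt; omega⟩) ∂P

/-- The feasible set `Π_r(μ,ν)` of the level-`r` relaxation. -/
def PiRSet [MeasurableSpace X] [MeasurableSpace Y] (r : ℕ)
    (μ : Measure X) (ν : Measure Y) : Set (Measure (Fin (2 * r) → X × Y)) :=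
  {P | IsProbabilityMeasure P ∧ SymCond r P ∧ MarCond r μ ν P ∧ PSDCond r P}

/-- The level-`r` SOS value `gw^{(r)}(μ,ν)`. -/
noncomputable def gwRVal [MeasurableSpace X] [MeasurableSpace Y] (r : ℕ) (hr : 0 < r)
    (c : X × Y → X × Y → ℝ) (μ : Measure X) (ν : Measure Y) : ℝ :=
  ⨅ P : PiRSet r μ ν,
    ∫ z, c (z ⟨0, by omega⟩) (z ⟨1, by omega⟩) ∂(P : Measure (Fin (2 * r) → X × Y))

/-- `c` is Lipschitz with constant `C` for the sum metric. -/
def LipCost [PseudoMetricSpace X] [PseudoMetricSpace Y] (C : ℝ)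
    (c : X × Y → X × Y → ℝ) : Prop :=
  ∀ z₁ z₂ w₁ w₂ : X × Y,
    |c z₁ z₂ - c w₁ w₂|
      ≤ C * (dist z₁.1 w₁.1 + dist z₁.2 w₁.2 + dist z₂.1 w₂.1 + dist z₂.2 w₂.2)

/-- The `L^{p,q}` distortion cost. -/
noncomputable def distCost [PseudoMetricSpace X] [PseudoMetricSpace Y] (p q : ℝ)
    (z w : X × Y) : ℝ :=
  |dist z.1 w.1 ^ q - dist z.2 w.2 ^ q| ^ p

end GWSOS

namespace GWSOS

section

variable {X Y : Type*}

/-- The indices of `Fin (2 * r)`, split into two blocks of length `t` and a remaining block. -/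
def blockMap (r t : ℕ) (ht : t ≤ r) : Fin t ⊕ (Fin t ⊕ Fin (2 * r - 2 * t)) → Fin (2 * r)
  | Sum.inl s => ⟨s.1, by have := s.isLt; omega⟩
  | Sum.inr (Sum.inl s) => ⟨t + s.1, by have := s.isLt; omega⟩
  | Sum.inr (Sum.inr s) => ⟨2 * t + s.1, by have := s.isLt; omega⟩

lemma blockMap_bijective (r t : ℕ) (ht : t ≤ r) : Function.Bijective (blockMap r t ht) := by
  rw [Fintype.bijective_iff_injective_and_card]
  constructor
  · rintro (⟨a, ha⟩ | ⟨a, ha⟩ | ⟨a, ha⟩) (⟨b, hb⟩ | ⟨b, hb⟩ | ⟨b, hb⟩) h <;>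
      simp only [blockMap, Fin.mk.injEq, Sum.inl.injEq, Sum.inr.injEq, reduceCtorEq] at h ⊢ <;>
      omega
  · simp
    omega

/-- `blockMap` as an equivalence. -/
noncomputable def blockEquiv (r t : ℕ) (ht : t ≤ r) :
    Fin t ⊕ (Fin t ⊕ Fin (2 * r - 2 * t)) ≃ Fin (2 * r) :=
  Equiv.ofBijective _ (blockMap_bijective r t ht)

lemma map_reindex_pi {ι ι' W : Type*} [Fintype ι] [Fintype ι'] [MeasurableSpace W]
    (π : Measure W) [SigmaFinite π] (e : ι' ≃ ι) :
    (Measure.pi fun _ : ι => π).map (fun z i => z (e i)) = Measure.pi fun _ : ι' => π := by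
  symm
  refine Measure.pi_eq fun s hs => ?_
  rw [Measure.map_apply (by fun_prop) (MeasurableSet.univ_pi hs)]
  have : (fun (z : ι → W) i => z (e i)) ⁻¹' univ.pi s = univ.pi fun i => s (e.symm i) := by
    ext z
    simp only [mem_preimage, mem_univ_pi]
    exact ⟨fun h i => by simpa using h (e.symm i), fun h i => by simpa using h (e i)⟩
  rw [this, Measure.pi_pi]
  exact Fintype.prod_equiv e.symm _ _ fun i => by simp

/-- The coordinates of `P` stay independent from the remaining ones after applying `π`, with
law `ν`. -/
def IsMar {ι W V : Type*} [MeasurableSpace W] [MeasurableSpace V] (π : W → V) (ν : Measure V)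
    (P : Measure (ι → W)) : Prop :=
  ∀ i : ι, P.map (fun z => (π (z i), fun j : {j : ι // j ≠ i} => z j.1))
    = ν.prod (P.map (fun z (j : {j : ι // j ≠ i}) => z j.1))

lemma marCond_iff [MeasurableSpace X] [MeasurableSpace Y] {r : ℕ} {μ : Measure X} {ν : Measure Y}
    {P : Measure (Fin (2 * r) → X × Y)} :
    MarCond r μ ν P ↔ IsMar Prod.fst μ P ∧ IsMar Prod.snd ν P :=
  forall_and

lemma isMar_pi {ι W V : Type*} [Fintype ι] [MeasurableSpace W] [MeasurableSpace V]
    {f : W → V} (hf : Measurable f) (π : Measure W) [IsProbabilityMeasure π] :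
    IsMar f (π.map f) (Measure.pi fun _ : ι => π) := by
  classical
  intro i
  have hmp := measurePreserving_piEquivPiSubtypeProd (fun _ : ι => π) (fun j => j = i)
  have hrest := (measurePreserving_snd.comp hmp).map_eq
  have hfst := (measurePreserving_fst.comp hmp).map_eq
  have heval := congrArg (Measure.map f) (measurePreserving_eval (fun _ : ι => π) i).map_eq
  rw [Measure.map_map hf (by fun_prop)] at heval
  have hmap := congrArg (Measure.map (Prod.map (fun w => f (w ⟨i, rfl⟩)) id)) hmp.map_eq
  rw [← Measure.map_prod_map _ _ (by fun_prop) measurable_id, ← hfst, ← hrest, Measure.map_id,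
    Measure.map_map (by fun_prop) (by fun_prop), Measure.map_map (by fun_prop) (by fun_prop)]
    at hmap
  rw [← heval]
  exact hmap

lemma pi_mem_PiRSet [MeasurableSpace X] [MeasurableSpace Y] (r : ℕ) (π : Measure (X × Y))
    [IsProbabilityMeasure π] :
    (Measure.pi fun _ : Fin (2 * r) => π) ∈ PiRSet r (π.map Prod.fst) (π.map Prod.snd) := by
  refine ⟨inferInstance, fun σ => map_reindex_pi π σ,
    marCond_iff.2 ⟨isMar_pi measurable_fst π, isMar_pi measurable_snd π⟩, ?_⟩
  intro t ht f g hf _ hg _ hg0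
  have h1 := map_reindex_pi π (blockEquiv r t ht)
  have h2 := measurePreserving_sumPiEquivProdPi
    (fun _ : Fin t ⊕ (Fin t ⊕ Fin (2 * r - 2 * t)) => π)
  have h3 := measurePreserving_sumPiEquivProdPi (fun _ : Fin t ⊕ Fin (2 * r - 2 * t) => π)
  have key : (Measure.pi fun _ : Fin (2 * r) => π).map
      (fun z => ((fun s => z (blockEquiv r t ht (.inl s)),
        (fun s => z (blockEquiv r t ht (.inr (.inl s))),
          fun s => z (blockEquiv r t ht (.inr (.inr s))))) :
          (Fin t → X × Y) × (Fin t → X × Y) × (Fin (2 * r - 2 * t) → X × Y))) =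
      (Measure.pi fun _ => π).prod ((Measure.pi fun _ => π).prod (Measure.pi fun _ => π)) := by
    have h4 := (MeasurePreserving.id (Measure.pi fun _ : Fin t => π)).prod h3
    have h5 := h4.comp (h2.comp ⟨by fun_prop, h1⟩)
    exact h5.map_eq
  have hInt : 0 ≤ ∫ w : (Fin t → X × Y) × (Fin t → X × Y) × (Fin (2 * r - 2 * t) → X × Y),
      f w.1 * (f w.2.1 * g w.2.2)
      ∂((Measure.pi fun _ => π).prod ((Measure.pi fun _ => π).prod (Measure.pi fun _ => π))) := by
    rw [integral_prod_mul f (fun w : (Fin t → X × Y) × (Fin (2 * r - 2 * t) → X × Y) =>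
      f w.1 * g w.2), integral_prod_mul f g, ← mul_assoc]
    exact mul_nonneg (mul_self_nonneg _) (integral_nonneg hg0)
  rw [← key, integral_map (by fun_prop) (by fun_prop)] at hInt
  simp only [← mul_assoc] at hInt
  exact hInt

lemma isMar_map_swap {ι V : Type*} [MeasurableSpace X] [MeasurableSpace Y] [MeasurableSpace V]
    {P : Measure (ι → X × Y)} [IsProbabilityMeasure P] {f : X × Y → V} (hf : Measurable f)
    {η : Measure V} [SFinite η] (h : IsMar f η P) :
    IsMar (fun w => f w.swap) η (P.map (fun z i => (z i).swap)) := by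
  intro i
  rw [Measure.map_map (by fun_prop) (by fun_prop), Measure.map_map (by fun_prop) (by fun_prop)]
  have := congrArg (Measure.map (Prod.map id
    (fun (z : {j : ι // j ≠ i} → X × Y) j => (z j).swap))) (h i)
  rw [← Measure.map_prod_map _ _ measurable_id (by fun_prop),
    Measure.map_map (by fun_prop) (by fun_prop), Measure.map_map (by fun_prop) (by fun_prop),
    Measure.map_id] at this
  exact this

lemma swap_mem_PiRSet [MeasurableSpace X] [MeasurableSpace Y] {r : ℕ} {μ : Measure X}
    {ν : Measure Y} {P : Measure (Fin (2 * r) → X × Y)} (hP : P ∈ PiRSet r μ ν)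
    [SFinite μ] [SFinite ν] :
    P.map (fun z i => (z i).swap) ∈ PiRSet r ν μ := by
  obtain ⟨hprob, hsym, hmar, hpsd⟩ := hP
  have hm : Measurable fun (z : Fin (2 * r) → X × Y) i => (z i).swap := by fun_prop
  rw [marCond_iff] at hmar
  refine ⟨Measure.isProbabilityMeasure_map hm.aemeasurable, fun σ => ?_,
    marCond_iff.2 ⟨isMar_map_swap measurable_snd hmar.2, isMar_map_swap measurable_fst hmar.1⟩, ?_⟩
  · conv_rhs => rw [← hsym σ]
    rw [Measure.map_map (by fun_prop) hm, Measure.map_map hm (by fun_prop)]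
    rfl
  · intro t ht f g hf hfb hg hgb hg0
    rw [integral_map hm.aemeasurable (by fun_prop)]
    exact hpsd t ht (fun w => f fun s => (w s).swap) (fun w => g fun s => (w s).swap)
      (by fun_prop) (hfb.imp fun M h w => h _) (by fun_prop) (hgb.imp fun M h w => h _)
      fun w => hg0 _

/-- The quadratic forms `f ↦ ∫ f(u) f(v) g(s) dP` with bounded `f` and bounded `g ≥ 0` are
nonnegative. -/
def IsPosForm {Ω U S : Type*} [MeasurableSpace Ω] [MeasurableSpace U] [MeasurableSpace S]
    (P : Measure Ω) (u v : Ω → U) (s : Ω → S) : Prop :=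
  ∀ (f : U → ℝ) (g : S → ℝ), Measurable f → (∃ M, ∀ w, |f w| ≤ M) →
    Measurable g → (∃ M, ∀ w, |g w| ≤ M) → (∀ w, 0 ≤ g w) →
    0 ≤ ∫ ω, f (u ω) * f (v ω) * g (s ω) ∂P

lemma integrable_of_abs_le {Ω : Type*} [MeasurableSpace Ω] {P : Measure Ω} [IsFiniteMeasure P]
    {f : Ω → ℝ} (hf : Measurable f) {M : ℝ} (hM : ∀ ω, |f ω| ≤ M) : Integrable f P :=
  Integrable.of_bound hf.aestronglyMeasurable M (Eventually.of_forall hM)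

lemma integral_posForm_finite {Ω U S B D : Type*} [MeasurableSpace Ω] [MeasurableSpace U]
    [MeasurableSpace S] [Fintype B] [Fintype D] [MeasurableSpace B] [MeasurableSpace D]
    [MeasurableSingletonClass B] [MeasurableSingletonClass D]
    {P : Measure Ω} [IsFiniteMeasure P] {u v : Ω → U} {s : Ω → S}
    (hu : Measurable u) (hv : Measurable v) (hs : Measurable s) (hP : IsPosForm P u v s)
    {m : Measure (B × B × D)} [IsFiniteMeasure m]
    (hm : ∀ (x : B → ℝ) (d : D), 0 ≤ ∑ b, ∑ b', x b * x b' * m.real {(b, b', d)})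
    (hsymm : ∀ b b' d, m.real {(b, b', d)} = m.real {(b', b, d)})
    {F : U → B → ℝ} (hF : ∀ b, Measurable fun w => F w b) {M : ℝ} (hFM : ∀ w b, |F w b| ≤ M)
    {G : S → D → ℝ} (hG : ∀ d, Measurable fun w => G w d) (hGM : ∀ w d, |G w d| ≤ M)
    (hG0 : ∀ w d, 0 ≤ G w d) :
    0 ≤ ∫ ω, ∫ w, F (u ω) w.1 * F (v ω) w.2.1 * G (s ω) w.2.2 ∂m ∂P := by
  classical
  have hpsd : ∀ d, (Matrix.of fun b b' => m.real {(b, b', d)}).PosSemidef := by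
    intro d
    refine Matrix.PosSemidef.of_dotProduct_mulVec_nonneg ?_ fun x => ?_
    · ext b b'
      exact hsymm b' b d
    · refine (hm x d).trans_eq ?_
      simp only [dotProduct, Matrix.mulVec, Finset.mul_sum, Matrix.of_apply]
      refine Finset.sum_congr rfl fun b _ => Finset.sum_congr rfl fun b' _ => ?_
      rw [Pi.star_apply, star_trivial]
      ring
  have hroot : ∀ d, ∃ (n : ℕ) (A : Fin n → B → ℝ),
      ∀ b b', m.real {(b, b', d)} = ∑ k, A k b * A k b' := by
    intro d
    obtain ⟨n, A, hA⟩ := Matrix.posSemidef_iff_eq_sum_vecMulVec.1 (hpsd d)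
    refine ⟨n, A, fun b b' => ?_⟩
    have := congrFun (congrFun hA b) b'
    simpa [Matrix.sum_apply, Matrix.vecMulVec_apply] using this
  choose n A hA using hroot
  have hinner : ∀ ω, ∫ w, F (u ω) w.1 * F (v ω) w.2.1 * G (s ω) w.2.2 ∂m =
      ∑ d, ∑ k, (∑ b, A d k b * F (u ω) b) * (∑ b, A d k b * F (v ω) b) * G (s ω) d := by
    intro ω
    rw [integral_fintype (Integrable.of_finite), Fintype.sum_prod_type]
    simp only [Fintype.sum_prod_type, hA, smul_eq_mul]
    calc ∑ b, ∑ b', ∑ d, (∑ k, A d k b * A d k b') *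
          (F (u ω) b * F (v ω) b' * G (s ω) d)
        = ∑ d, ∑ b, ∑ b', ∑ k, A d k b * A d k b' * (F (u ω) b * F (v ω) b' * G (s ω) d) := by
          simp only [Finset.sum_mul]
          rw [Finset.sum_congr rfl fun b _ => Finset.sum_comm, Finset.sum_comm]
      _ = ∑ d, ∑ k, ∑ b, ∑ b', A d k b * A d k b' * (F (u ω) b * F (v ω) b' * G (s ω) d) := by
          refine Finset.sum_congr rfl fun d _ => ?_
          rw [Finset.sum_congr rfl fun b _ => Finset.sum_comm, Finset.sum_comm]
      _ = _ := by
          refine Finset.sum_congr rfl fun d _ => Finset.sum_congr rfl fun k _ => ?_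
          rw [Finset.sum_mul_sum, Finset.sum_mul]
          refine Finset.sum_congr rfl fun b _ => ?_
          rw [Finset.sum_mul]
          exact Finset.sum_congr rfl fun b' _ => by ring
  have hfm : ∀ d k, Measurable fun w => ∑ b, A d k b * F w b := fun d k =>
    Finset.measurable_sum _ fun b _ => (hF b).const_mul _
  have hfb : ∀ d k, ∀ w, |∑ b, A d k b * F w b| ≤ ∑ b, |A d k b| * M := fun d k w =>
    (Finset.abs_sum_le_sum_abs _ _).trans <| Finset.sum_le_sum fun b _ => by
      rw [abs_mul]
      exact mul_le_mul_of_nonneg_left (hFM w b) (abs_nonneg _)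
  have hInt : ∀ d k, Integrable (fun ω => (∑ b, A d k b * F (u ω) b) *
      (∑ b, A d k b * F (v ω) b) * G (s ω) d) P := by
    intro d k
    refine integrable_of_abs_le
      ((((hfm d k).comp hu).mul ((hfm d k).comp hv)).mul ((hG d).comp hs))
      (M := (∑ b, |A d k b| * M) * (∑ b, |A d k b| * M) * M) fun ω => ?_
    have h0 : 0 ≤ ∑ b, |A d k b| * M := (abs_nonneg _).trans (hfb d k (u ω))
    simp only [abs_mul]
    gcongr
    · exact hfb d k _
    · exact hfb d k _
    · exact hGM _ _
  simp only [hinner]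
  rw [integral_finsetSum _ fun d _ => integrable_finsetSum _ fun k _ => hInt d k]
  refine Finset.sum_nonneg fun d _ => ?_
  rw [integral_finsetSum _ fun k _ => hInt d k]
  refine Finset.sum_nonneg fun k _ => ?_
  exact hP _ _ (hfm d k) ⟨_, hfb d k⟩ (hG d) ⟨M, fun w => hGM w d⟩ fun w => hG0 w d

lemma exists_simpleFunc_approx {W V : Type*}
    [MetricSpace W] [SecondCountableTopology W] [MeasurableSpace W] [BorelSpace W]
    [MetricSpace V] [SecondCountableTopology V] [MeasurableSpace V] [BorelSpace V] [Nonempty V]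
    (m : Measure (W × V)) [IsFiniteMeasure m] {F : W × V → ℝ} (hF : Measurable F) {lo hi : ℝ}
    (hlo : ∀ w, lo ≤ F w) (hhi : ∀ w, F w ≤ hi) {ε : ℝ} (hε : 0 < ε) :
    ∃ (h : W × V → ℝ) (a : SimpleFunc V V), Measurable h ∧ (∀ w, lo ≤ h w) ∧ (∀ w, h w ≤ hi) ∧
      ∫ w, |F w - h (w.1, a w.2)| ∂m ≤ ε := by
  have hlohi : ∀ w : W × V, lo ≤ hi := fun w => (hlo w).trans (hhi w)
  have hFi : Integrable F m := integrable_of_abs_le hF (M := max |lo| |hi|)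
    fun ω => abs_le_max_abs_abs (hlo ω) (hhi ω)
  obtain ⟨g, hg, hgi⟩ := hFi.exists_boundedContinuous_integral_sub_le (half_pos hε)
  set h : W × V → ℝ := fun w => max lo (min hi (g w)) with hh
  have hhc : Continuous h := by fun_prop
  have hhlo : ∀ w, lo ≤ h w := fun w => le_max_left _ _
  have hhhi : ∀ w, h w ≤ hi := fun w => max_le (hlohi w) (min_le_left _ _)
  have hclip : ∀ w, |F w - h w| ≤ |F w - g w| := by
    intro w
    have h1 := hlo w
    have h2 := hhi w
    grind
  set a : ℕ → SimpleFunc V V := fun n => SimpleFunc.nearestPt (TopologicalSpace.denseSeq V) n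
  have hlim : Tendsto (fun n => ∫ w, |h w - h (w.1, a n w.2)| ∂m) atTop (nhds 0) := by
    have hz : (0 : ℝ) = ∫ w : W × V, (0 : ℝ) ∂m := by simp
    rw [hz]
    refine tendsto_integral_of_dominated_convergence (fun _ => hi - lo) (fun n => ?_)
      (integrable_const _) (fun n => Eventually.of_forall fun w => ?_)
      (Eventually.of_forall fun w => ?_)
    · exact (hhc.measurable.sub (hhc.measurable.comp (measurable_fst.prodMk
        ((a n).measurable.comp measurable_snd)))).abs.aestronglyMeasurable
    · rw [Real.norm_eq_abs, abs_abs, abs_le]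
      constructor <;> linarith [hhlo w, hhhi w, hhlo (w.1, a n w.2), hhhi (w.1, a n w.2)]
    · have ht : Tendsto (fun n => a n w.2) atTop (nhds w.2) :=
        SimpleFunc.tendsto_nearestPt (by
          rw [(TopologicalSpace.denseRange_denseSeq V).closure_range]; trivial)
      have h1 : Tendsto (fun n => h (w.1, a n w.2)) atTop (nhds (h (w.1, w.2))) :=
        (hhc.tendsto _).comp (tendsto_const_nhds.prodMk_nhds ht)
      simpa using (h1.const_sub (h w)).abs
  obtain ⟨n, hn⟩ := (hlim.eventually (ge_mem_nhds (half_pos hε))).exists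
  have hm2 : Measurable fun w : W × V => h (w.1, a n w.2) :=
    hhc.measurable.comp (measurable_fst.prodMk ((a n).measurable.comp measurable_snd))
  have hi1 : Integrable h m := integrable_of_abs_le hhc.measurable (M := max |lo| |hi|)
    fun ω => abs_le_max_abs_abs (hhlo ω) (hhhi ω)
  have hi2 : Integrable (fun w : W × V => h (w.1, a n w.2)) m :=
    integrable_of_abs_le hm2 (M := max |lo| |hi|)
      fun ω => abs_le_max_abs_abs (hhlo _) (hhhi _)
  refine ⟨h, a n, hhc.measurable, hhlo, hhhi, ?_⟩
  calc ∫ w, |F w - h (w.1, a n w.2)| ∂m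
      ≤ ∫ w, (|F w - g w| + |h w - h (w.1, a n w.2)|) ∂m := by
        refine integral_mono (hFi.sub hi2).abs ((hFi.sub hgi).abs.add (hi1.sub hi2).abs)
          fun w => ?_
        exact (abs_sub_le _ (h w) _).trans (add_le_add_left (hclip w) _)
    _ = ∫ w, |F w - g w| ∂m + ∫ w, |h w - h (w.1, a n w.2)| ∂m :=
        integral_add (hFi.sub hgi).abs (hi1.sub hi2).abs
    _ ≤ ε / 2 + ε / 2 := add_le_add hg hn
    _ = ε := by ring

lemma integral_mul_nonneg_of_approx {Ω A C : Type*} [MeasurableSpace Ω] [MeasurableSpace A]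
    [MeasurableSpace C] {m : Measure Ω} [IsFiniteMeasure m] {α β : Ω → A} {γ : Ω → C}
    (hα : Measurable α) (hβ : Measurable β) (hγ : Measurable γ) {F : A → ℝ} {G : C → ℝ}
    (hF : Measurable F) (hG : Measurable G) {M : ℝ} (hM : 0 ≤ M) (hFM : ∀ w, |F w| ≤ M)
    (hGM : ∀ w, |G w| ≤ M)
    (happ : ∀ ε > 0, ∃ (F' : A → ℝ) (G' : C → ℝ), Measurable F' ∧ Measurable G' ∧
      (∀ w, |F' w| ≤ M) ∧ (∀ w, |G' w| ≤ M) ∧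
      ∫ ω, |F (α ω) - F' (α ω)| ∂m ≤ ε ∧ ∫ ω, |F (β ω) - F' (β ω)| ∂m ≤ ε ∧
      ∫ ω, |G (γ ω) - G' (γ ω)| ∂m ≤ ε ∧ 0 ≤ ∫ ω, F' (α ω) * F' (β ω) * G' (γ ω) ∂m) :
    0 ≤ ∫ ω, F (α ω) * F (β ω) * G (γ ω) ∂m := by
  have hlow : ∀ ε > 0, -(M ^ 2 * (3 * ε)) ≤ ∫ ω, F (α ω) * F (β ω) * G (γ ω) ∂m := by
    intro ε hε
    obtain ⟨F', G', hF', hG', hFM', hGM', h1, h2, h3, h4⟩ := happ ε hε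
    have hInt : ∀ {F : A → ℝ} {G : C → ℝ}, Measurable F → Measurable G → (∀ w, |F w| ≤ M) →
        (∀ w, |G w| ≤ M) → Integrable (fun ω => F (α ω) * F (β ω) * G (γ ω)) m := by
      intro F G hF hG hFM hGM
      refine integrable_of_abs_le (by fun_prop) (M := M * M * M) fun ω => ?_
      rw [abs_mul, abs_mul]
      gcongr <;> apply_assumption
    have hdist : ∀ {δ : Ω → A} {H H' : A → ℝ}, Measurable δ →
        Measurable H → Measurable H' → (∀ w, |H w| ≤ M) → (∀ w, |H' w| ≤ M) →
        Integrable (fun ω => |H (δ ω) - H' (δ ω)|) m := fun hδ hH hH' hHM hHM' =>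
      ((integrable_of_abs_le (hH.comp hδ) fun _ => hHM _).sub
        (integrable_of_abs_le (hH'.comp hδ) fun _ => hHM' _)).abs
    have hi1 := hdist hα hF hF' hFM hFM'
    have hi2 := hdist hβ hF hF' hFM hFM'
    have hi3 : Integrable (fun ω => |G (γ ω) - G' (γ ω)|) m :=
      ((integrable_of_abs_le (hG.comp hγ) fun _ => hGM _).sub
        (integrable_of_abs_le (hG'.comp hγ) fun _ => hGM' _)).abs
    have hi12 : Integrable (fun ω => |F (α ω) - F' (α ω)| + |F (β ω) - F' (β ω)|) m := hi1.add hi2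
    have hpt : ∀ ω, F' (α ω) * F' (β ω) * G' (γ ω) - F (α ω) * F (β ω) * G (γ ω) ≤
        M ^ 2 * (|F (α ω) - F' (α ω)| + |F (β ω) - F' (β ω)| + |G (γ ω) - G' (γ ω)|) := by
      intro ω
      have hprod : ∀ a b c : ℝ, |b| ≤ M → |c| ≤ M → -(a * b * c) ≤ M ^ 2 * |a| := by
        intro a b c hb hc
        calc -(a * b * c) ≤ |a * b * c| := neg_le_abs _
          _ = |a| * |b| * |c| := by rw [abs_mul, abs_mul]
          _ ≤ |a| * M * M := by gcongr
          _ = M ^ 2 * |a| := by ring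
      have e1 := hprod (F (α ω) - F' (α ω)) (F (β ω)) (G (γ ω)) (hFM _) (hGM _)
      have e2 := hprod (F (β ω) - F' (β ω)) (F' (α ω)) (G (γ ω)) (hFM' _) (hGM _)
      have e3 := hprod (G (γ ω) - G' (γ ω)) (F' (α ω)) (F' (β ω)) (hFM' _) (hFM' _)
      linarith
    have hmono : ∫ ω, (F' (α ω) * F' (β ω) * G' (γ ω) - F (α ω) * F (β ω) * G (γ ω)) ∂m ≤
        ∫ ω, M ^ 2 * (|F (α ω) - F' (α ω)| + |F (β ω) - F' (β ω)| + |G (γ ω) - G' (γ ω)|) ∂m :=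
      integral_mono ((hInt hF' hG' hFM' hGM').sub (hInt hF hG hFM hGM))
        ((hi12.add hi3).const_mul (M ^ 2)) hpt
    rw [integral_sub (hInt hF' hG' hFM' hGM') (hInt hF hG hFM hGM), integral_const_mul,
      integral_add hi12 hi3, integral_add hi1 hi2] at hmono
    have hsum := mul_le_mul_of_nonneg_left (add_le_add (add_le_add h1 h2) h3) (sq_nonneg M)
    linarith
  by_contra! hneg
  have := hlow (-(∫ ω, F (α ω) * F (β ω) * G (γ ω) ∂m) / (6 * (M ^ 2 + 1))) (by
    apply div_pos <;> [linarith; positivity])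
  set I := ∫ ω, F (α ω) * F (β ω) * G (γ ω) ∂m
  have h6 : M ^ 2 * (3 * (-I / (6 * (M ^ 2 + 1)))) = (M ^ 2 / (M ^ 2 + 1)) * (-I / 2) := by
    field_simp
    ring
  have h7 : M ^ 2 / (M ^ 2 + 1) ≤ 1 := by
    rw [div_le_one (by positivity)]
    linarith
  rw [h6] at this
  nlinarith

lemma IsPosForm.prod {Ω Ω' U S U' S' : Type*} [MeasurableSpace Ω] [MeasurableSpace Ω']
    [MetricSpace U] [SecondCountableTopology U] [MeasurableSpace U] [BorelSpace U]
    [MetricSpace S] [SecondCountableTopology S] [MeasurableSpace S] [BorelSpace S]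
    [MetricSpace U'] [SecondCountableTopology U'] [MeasurableSpace U'] [BorelSpace U']
    [MetricSpace S'] [SecondCountableTopology S'] [MeasurableSpace S'] [BorelSpace S']
    {P : Measure Ω} [IsProbabilityMeasure P] {u v : Ω → U} {s : Ω → S}
    (hu : Measurable u) (hv : Measurable v) (hs : Measurable s) (hP : IsPosForm P u v s)
    {Q : Measure Ω'} [IsProbabilityMeasure Q] {u' v' : Ω' → U'} {s' : Ω' → S'}
    (hu' : Measurable u') (hv' : Measurable v') (hs' : Measurable s') (hQ : IsPosForm Q u' v' s')
    (hsymm : Q.map (fun ω => (u' ω, v' ω, s' ω)) = Q.map (fun ω => (v' ω, u' ω, s' ω))) :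
    IsPosForm (P.prod Q) (fun ω => (u ω.1, u' ω.2)) (fun ω => (v ω.1, v' ω.2))
      (fun ω => (s ω.1, s' ω.2)) := by
  classical
  intro F G hF ⟨MF, hMF⟩ hG ⟨MG, hMG⟩ hG0
  have : Nonempty Ω' := nonempty_of_isProbabilityMeasure Q
  have : Nonempty U' := ‹Nonempty Ω'›.map u'
  have : Nonempty S' := ‹Nonempty Ω'›.map s'
  set M := max |MF| |MG| with hMdef
  have hFM : ∀ w, |F w| ≤ M := fun w => (hMF w).trans ((le_abs_self _).trans (le_max_left _ _))
  have hGM : ∀ w, |G w| ≤ M := fun w => (hMG w).trans ((le_abs_self _).trans (le_max_right _ _))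
  have hα : Measurable fun ω : Ω × Ω' => (u ω.1, u' ω.2) := by fun_prop
  have hβ : Measurable fun ω : Ω × Ω' => (v ω.1, v' ω.2) := by fun_prop
  have hγ : Measurable fun ω : Ω × Ω' => (s ω.1, s' ω.2) := by fun_prop
  refine integral_mul_nonneg_of_approx hα hβ hγ hF hG
    ((abs_nonneg _).trans (le_max_left _ _)) hFM hGM fun ε hε => ?_
  obtain ⟨h, a, hh, hhlo, hhhi, hha⟩ := exists_simpleFunc_approx
    ((P.prod Q).map (fun ω => (u ω.1, u' ω.2)) + (P.prod Q).map (fun ω => (v ω.1, v' ω.2)))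
    hF (fun w => (abs_le.1 (hFM w)).1) (fun w => (abs_le.1 (hFM w)).2) hε
  obtain ⟨g, c, hg, hglo, hghi, hgc⟩ := exists_simpleFunc_approx
    ((P.prod Q).map (fun ω => (s ω.1, s' ω.2))) hG hG0 (fun w => (abs_le.1 (hGM w)).2) hε
  have hha' : Measurable fun w : U × U' => h (w.1, a w.2) :=
    hh.comp (measurable_fst.prodMk (a.measurable.comp measurable_snd))
  have hgc' : Measurable fun w : S × S' => g (w.1, c w.2) :=
    hg.comp (measurable_fst.prodMk (c.measurable.comp measurable_snd))
  have hhM : ∀ w, |h w| ≤ M := fun w => abs_le.2 ⟨hhlo w, hhhi w⟩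
  have hgM : ∀ w, |g w| ≤ M := fun w => by rw [abs_of_nonneg (hglo w)]; exact hghi w
  have hdiff : Measurable fun w : U × U' => |F w - h (w.1, a w.2)| := (hF.sub hha').abs
  have hdint : ∀ m : Measure (U × U'), IsFiniteMeasure m →
      Integrable (fun w : U × U' => |F w - h (w.1, a w.2)|) m := fun m _ =>
    ((integrable_of_abs_le hF hFM).sub (integrable_of_abs_le hha' fun _ => hhM _)).abs
  rw [integral_add_measure (hdint _ inferInstance) (hdint _ inferInstance),
    integral_map hα.aemeasurable hdiff.aestronglyMeasurable,
    integral_map hβ.aemeasurable hdiff.aestronglyMeasurable] at hha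
  have hdiffG : Measurable fun w : S × S' => |G w - g (w.1, c w.2)| := (hG.sub hgc').abs
  rw [integral_map hγ.aemeasurable hdiffG.aestronglyMeasurable] at hgc
  refine ⟨fun w => h (w.1, a w.2), fun w => g (w.1, c w.2), hha', hgc', fun _ => hhM _,
    fun _ => hgM _, ?_, ?_, hgc, ?_⟩
  · exact (le_add_of_nonneg_right (integral_nonneg fun _ => abs_nonneg _)).trans hha
  · exact (le_add_of_nonneg_left (integral_nonneg fun _ => abs_nonneg _)).trans hha
  have ha_range : Measurable fun w : U' => (⟨a w, a.mem_range_self w⟩ : a.range) :=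
    a.measurable.subtype_mk
  have hc_range : Measurable fun w : S' => (⟨c w, c.mem_range_self w⟩ : c.range) :=
    c.measurable.subtype_mk
  set T : U' × U' × S' → a.range × a.range × c.range := fun w =>
    (⟨a w.1, a.mem_range_self _⟩, ⟨a w.2.1, a.mem_range_self _⟩, ⟨c w.2.2, c.mem_range_self _⟩)
    with hTdef
  have hT : Measurable T := (ha_range.comp measurable_fst).prodMk
    ((ha_range.comp (measurable_fst.comp measurable_snd)).prodMk
      (hc_range.comp (measurable_snd.comp measurable_snd)))
  have hTu : Measurable fun ω => T (u' ω, v' ω, s' ω) := by fun_prop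
  have hTv : Measurable fun ω => T (v' ω, u' ω, s' ω) := by fun_prop
  set m := Q.map fun ω => T (u' ω, v' ω, s' ω) with hmdef
  have : IsProbabilityMeasure m := Measure.isProbabilityMeasure_map hTu.aemeasurable
  have hmain := integral_posForm_finite hu hv hs hP (m := m) ?_ ?_
    (F := fun w b => h (w, b)) (M := M) (fun b => by fun_prop) (fun _ _ => hhM _)
    (G := fun w d => g (w, d)) (fun b => by fun_prop) (fun _ _ => hgM _) fun _ _ => hglo _
  · rw [integral_prod]
    · convert hmain using 3 with ω
      rw [hmdef, integral_map hTu.aemeasurable]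
      exact (measurable_of_finite _).aestronglyMeasurable
    · refine integrable_of_abs_le (M := M * M * M)
        (((hha'.comp hα).mul (hha'.comp hβ)).mul (hgc'.comp hγ)) fun ω => ?_
      simp only [abs_mul]
      have := (abs_nonneg _).trans (le_max_left |MF| |MG|)
      gcongr <;> apply_assumption
  · intro x d
    have hpos := hQ (fun w => x ⟨a w, a.mem_range_self w⟩)
      (fun w => if (⟨c w, c.mem_range_self w⟩ : c.range) = d then 1 else 0)
      ((measurable_of_finite x).comp ha_range)
      ⟨∑ b, |x b|, fun w => Finset.single_le_sum (f := fun b => |x b|)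
        (fun _ _ => abs_nonneg _) (Finset.mem_univ _)⟩
      ((measurable_of_finite (fun e : c.range => if e = d then (1 : ℝ) else 0)).comp hc_range)
      ⟨1, fun w => by split_ifs <;> simp⟩ (fun w => by split_ifs <;> simp)
    have hrw : ∫ ω, x ⟨a (u' ω), a.mem_range_self _⟩ * x ⟨a (v' ω), a.mem_range_self _⟩ *
        (if (⟨c (s' ω), c.mem_range_self _⟩ : c.range) = d then 1 else 0) ∂Q =
        ∫ w, x w.1 * x w.2.1 * (if w.2.2 = d then 1 else 0) ∂m := by
      rw [hmdef, integral_map hTu.aemeasurable]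
      exact (measurable_of_finite _).aestronglyMeasurable
    rw [hrw, integral_fintype Integrable.of_finite] at hpos
    simpa [Fintype.sum_prod_type, mul_comm] using hpos
  · intro b b' d
    have hm2 : m = Q.map fun ω => T (v' ω, u' ω, s' ω) := by
      have := congrArg (Measure.map T) hsymm
      rwa [Measure.map_map hT (by fun_prop), Measure.map_map hT (by fun_prop)] at this
    rw [measureReal_def, measureReal_def]
    nth_rewrite 2 [hm2]
    rw [hmdef, Measure.map_apply hTu (MeasurableSet.singleton _),
      Measure.map_apply hTv (MeasurableSet.singleton _)]
    congr 2
    ext ω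
    simp only [hTdef, mem_preimage, mem_singleton_iff, Prod.mk.injEq]
    tauto

lemma IsMar.lintegral_eq {ι W V : Type*} [MeasurableSpace W] [MeasurableSpace V] {π : W → V}
    {ν : Measure V} [SFinite ν] {P : Measure (ι → W)} [SFinite P] (h : IsMar π ν P)
    (hπ : Measurable π) (i : ι) {H : V × ({j : ι // j ≠ i} → W) → ENNReal} (hH : Measurable H) :
    ∫⁻ z, H (π (z i), fun j => z j) ∂P = ∫⁻ z, ∫⁻ v, H (v, fun j => z j) ∂ν ∂P := by
  have h1 : ∫⁻ w, H w ∂_ = ∫⁻ w, H w ∂_ := congrArg (fun m => ∫⁻ w, H w ∂m) (h i)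
  rw [lintegral_map hH (by fun_prop), lintegral_prod_symm _ hH.aemeasurable,
    lintegral_map (hH.lintegral_prod_left') (by fun_prop)] at h1
  exact h1

lemma IsMar.map_eval {ι W V : Type*} [MeasurableSpace W] [MeasurableSpace V] {π : W → V}
    {ν : Measure V} {P : Measure (ι → W)} [IsProbabilityMeasure P] (h : IsMar π ν P)
    (hπ : Measurable π) (i : ι) : P.map (fun z => π (z i)) = ν := by
  have h1 := congrArg (Measure.map Prod.fst) (h i)
  have : IsProbabilityMeasure (P.map (fun z (j : {j : ι // j ≠ i}) => z j.1)) :=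
    Measure.isProbabilityMeasure_map
      (measurable_pi_lambda _ fun j => measurable_pi_apply j.1).aemeasurable
  rw [Measure.map_map (by fun_prop) (by fun_prop), Measure.map_fst_prod, measure_univ,
    one_smul] at h1
  exact h1

lemma IsMar.ae_eval {ι W V : Type*} [MeasurableSpace W] [MeasurableSpace V] {π : W → V}
    {ν : Measure V} {P : Measure (ι → W)} [IsProbabilityMeasure P] (h : IsMar π ν P)
    (hπ : Measurable π) (i : ι) {p : V → Prop} (hp : ∀ᵐ v ∂ν, p v) : ∀ᵐ z ∂P, p (π (z i)) := by
  rw [← h.map_eval hπ i] at hp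
  exact ae_of_ae_map (hπ.comp (measurable_pi_apply i)).aemeasurable hp

lemma IsMar.lintegral_prod_eq {ι W V : Type*} [MeasurableSpace W] [MeasurableSpace V]
    {π : W → V} {ν : Measure V} [SFinite ν] {P : Measure (ι → W)} [IsProbabilityMeasure P]
    (h : IsMar π ν P) (hπ : Measurable π) {φ : ι → V → ENNReal} (hφ : ∀ i, Measurable (φ i))
    (F : Finset ι) :
    ∫⁻ z, ∏ i ∈ F, φ i (π (z i)) ∂P = ∏ i ∈ F, ∫⁻ v, φ i v ∂ν := by
  classical
  induction F using Finset.induction_on with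
  | empty => simp
  | insert i F hi ih =>
    have hne : ∀ j ∈ F, j ≠ i := fun j hj hji => hi (hji ▸ hj)
    have h1 := h.lintegral_eq hπ i
      (H := fun w => φ i w.1 * ∏ j ∈ F.subtype (· ≠ i), φ j.1 (π (w.2 j)))
      (((hφ i).comp measurable_fst).mul (Finset.measurable_fun_prod _ fun j _ => by fun_prop))
    simp only [Finset.prod_insert hi, ← ih]
    have hsub : ∀ z : ι → W, ∏ j ∈ F.subtype (· ≠ i), φ j.1 (π (z j.1)) =
        ∏ j ∈ F, φ j (π (z j)) := fun z =>
      Finset.prod_subtype_of_mem (fun j => φ j (π (z j))) hne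
    simp only [hsub] at h1
    rw [h1]
    simp only [lintegral_mul_const _ (hφ i)]
    rw [lintegral_const_mul _ (Finset.measurable_fun_prod _ fun j _ => by fun_prop)]

/-- A bounded density with respect to `ν ⊗ ν` whose two marginals are `ν`. -/
structure IsBistochastic {V : Type*} [MeasurableSpace V] (ν : Measure V)
    (k : V → V → NNReal) : Prop where
  measurable : Measurable fun w : V × V => k w.1 w.2
  bounded : ∃ M, ∀ y y', k y y' ≤ M
  left : ∀ᵐ y ∂ν, ∫⁻ y', k y y' ∂ν = 1
  right : ∀ᵐ y' ∂ν, ∫⁻ y, k y y' ∂ν = 1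

lemma IsBistochastic.flip {V : Type*} [MeasurableSpace V] {ν : Measure V} {k : V → V → NNReal}
    (hk : IsBistochastic ν k) : IsBistochastic ν (fun y y' => k y' y) where
  measurable := hk.measurable.comp measurable_swap
  bounded := hk.bounded.imp fun _ h y y' => h y' y
  left := hk.right
  right := hk.left

/-- The product of `P` and `Q`, reweighted by the product of the kernel `k` over all
coordinates. -/
noncomputable def glue {ι W W' V : Type*} [Fintype ι] [MeasurableSpace W] [MeasurableSpace W']
    (k : V → V → NNReal) (c : W → V) (c' : W' → V) (P : Measure (ι → W)) (Q : Measure (ι → W')) :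
    Measure ((ι → W) × (ι → W')) :=
  (P.prod Q).withDensity fun ω => ((∏ i, k (c (ω.1 i)) (c' (ω.2 i)) : NNReal) : ENNReal)

section glue

variable {ι W W' V : Type*} [Fintype ι] [MeasurableSpace W] [MeasurableSpace W']
  [MeasurableSpace V] {ν : Measure V} {k : V → V → NNReal} {c : W → V} {c' : W' → V}
  {P : Measure (ι → W)} {Q : Measure (ι → W')}

lemma IsBistochastic.measurable_comp {Ω : Type*} [MeasurableSpace Ω] (hk : IsBistochastic ν k)
    {f g : Ω → V} (hf : Measurable f) (hg : Measurable g) : Measurable fun ω => k (f ω) (g ω) :=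
  hk.measurable.comp (hf.prodMk hg)

lemma IsBistochastic.measurable_prod (hk : IsBistochastic ν k) (hc : Measurable c)
    (hc' : Measurable c') (ι' : Type*) [Fintype ι'] :
    Measurable fun ω : (ι' → W) × (ι' → W') => ∏ i, k (c (ω.1 i)) (c' (ω.2 i)) :=
  Finset.measurable_fun_prod _ fun i _ => hk.measurable_comp (by fun_prop) (by fun_prop)

lemma lintegral_glue (hk : IsBistochastic ν k) (hc : Measurable c) (hc' : Measurable c')
    {f : (ι → W) × (ι → W') → ENNReal} (hf : Measurable f) :
    ∫⁻ ω, f ω ∂glue k c c' P Q =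
      ∫⁻ ω, ((∏ i, k (c (ω.1 i)) (c' (ω.2 i)) : NNReal) : ENNReal) * f ω ∂(P.prod Q) :=
  lintegral_withDensity_eq_lintegral_mul _ (hk.measurable_prod hc hc' ι).coe_nnreal_ennreal hf

variable [IsProbabilityMeasure P] [IsProbabilityMeasure Q]

lemma glue_map_swap (hk : IsBistochastic ν k) (hc : Measurable c) (hc' : Measurable c') :
    (glue k c c' P Q).map Prod.swap = glue (fun y y' => k y' y) c' c Q P := by
  refine Measure.ext_of_lintegral _ fun f hf => ?_
  rw [lintegral_map hf measurable_swap, lintegral_glue hk hc hc' (f := fun ω => f ω.swap)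
    (hf.comp measurable_swap),
    lintegral_glue hk.flip hc' hc hf]
  have hJ : Measurable fun ω : (ι → W') × (ι → W) =>
      ((∏ i, k (c (ω.2 i)) (c' (ω.1 i)) : NNReal) : ENNReal) * f ω :=
    (hk.flip.measurable_prod hc' hc ι).coe_nnreal_ennreal.mul hf
  conv_rhs => rw [← Measure.prod_swap, lintegral_map hJ measurable_swap]
  rfl

lemma map_glue_perm (hk : IsBistochastic ν k) (hc : Measurable c) (hc' : Measurable c')
    (σ : Equiv.Perm ι) (hP : P.map (fun z => z ∘ σ) = P) (hQ : Q.map (fun z => z ∘ σ) = Q) :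
    (glue k c c' P Q).map (fun ω => (ω.1 ∘ σ, ω.2 ∘ σ)) = glue k c c' P Q := by
  have hPm : Measurable fun z : ι → W => z ∘ σ := by fun_prop
  have hQm : Measurable fun z : ι → W' => z ∘ σ := by fun_prop
  have hm : Measurable fun ω : (ι → W) × (ι → W') => (ω.1 ∘ σ, ω.2 ∘ σ) := by fun_prop
  have hPQ : (P.prod Q).map (fun ω => (ω.1 ∘ σ, ω.2 ∘ σ)) = P.prod Q := by
    have h := Measure.map_prod_map P Q hPm hQm
    rw [hP, hQ] at h
    exact h.symm
  refine Measure.ext_of_lintegral _ fun f hf => ?_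
  rw [lintegral_map hf hm, lintegral_glue hk hc hc'
    (f := fun ω => f (ω.1 ∘ σ, ω.2 ∘ σ)) (hf.comp hm), lintegral_glue hk hc hc' hf]
  have hJ : Measurable fun ω : (ι → W) × (ι → W') =>
      ((∏ i, k (c (ω.1 i)) (c' (ω.2 i)) : NNReal) : ENNReal) * f ω :=
    (hk.measurable_prod hc hc' ι).coe_nnreal_ennreal.mul hf
  conv_rhs => rw [← hPQ, lintegral_map hJ hm]
  refine lintegral_congr fun ω => ?_
  congr 2
  exact (Equiv.prod_comp σ fun i => k (c (ω.1 i)) (c' (ω.2 i))).symm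

variable [SFinite ν]

lemma glue_map_fst (hk : IsBistochastic ν k) (hc : Measurable c) (hc' : Measurable c')
    (hP : IsMar c ν P) (hQ : IsMar c' ν Q) : (glue k c c' P Q).map Prod.fst = P := by
  refine Measure.ext_of_lintegral _ fun f hf => ?_
  have hρ := (hk.measurable_prod hc hc' ι).coe_nnreal_ennreal
  rw [lintegral_map hf measurable_fst, lintegral_glue hk hc hc' (f := fun ω => f ω.1)
    (hf.comp measurable_fst),
    lintegral_prod (fun ω => _ * f ω.1) (hρ.mul (hf.comp measurable_fst)).aemeasurable]
  refine lintegral_congr_ae ?_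
  filter_upwards [ae_all_iff.2 fun i => hP.ae_eval hc i hk.left] with z hz
  have hρz : Measurable fun z' : ι → W' => ((∏ i, k (c (z i)) (c' (z' i)) : NNReal) : ENNReal) :=
    hρ.comp measurable_prodMk_left
  rw [lintegral_mul_const _ hρz]
  have h1 := hQ.lintegral_prod_eq hc' (φ := fun i y => (k (c (z i)) y : ENNReal))
    (fun i => (hk.measurable.comp measurable_prodMk_left).coe_nnreal_ennreal) Finset.univ
  simp only [hz, Finset.prod_const_one] at h1
  push_cast
  rw [h1, one_mul]

lemma glue_map_snd (hk : IsBistochastic ν k) (hc : Measurable c) (hc' : Measurable c')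
    (hP : IsMar c ν P) (hQ : IsMar c' ν Q) : (glue k c c' P Q).map Prod.snd = Q := by
  have h := glue_map_fst hk.flip hc' hc hQ hP
  rw [← glue_map_swap hk hc hc', Measure.map_map measurable_fst measurable_swap] at h
  exact h

lemma isProbabilityMeasure_glue (hk : IsBistochastic ν k) (hc : Measurable c)
    (hc' : Measurable c') (hP : IsMar c ν P) (hQ : IsMar c' ν Q) :
    IsProbabilityMeasure (glue k c c' P Q) := by
  constructor
  have h := congrArg (fun m => m univ) (glue_map_fst hk hc hc' hP hQ)
  simpa [Measure.map_apply measurable_fst] using h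

lemma lintegral_glue_of_isMar {A : Type*} [MeasurableSpace A] {μ : Measure A}
    [IsProbabilityMeasure μ] {a : W → A} (hk : IsBistochastic ν k) (hc : Measurable c)
    (hc' : Measurable c') (ha : Measurable a) (hP : IsMar c ν P) (hPa : IsMar a μ P)
    (hQ : IsMar c' ν Q) (i : ι)
    {H : A × ({j : ι // j ≠ i} → W) × ({j : ι // j ≠ i} → W') → ENNReal} (hH : Measurable H) :
    ∫⁻ ω, H (a (ω.1 i), fun j => ω.1 j, fun j => ω.2 j) ∂glue k c c' P Q =
      ∫⁻ ω, ∫⁻ x, H (x, fun j => ω.1 j, fun j => ω.2 j) ∂μ ∂glue k c c' P Q := by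
  classical
  have key : ∀ {H : A × ({j : ι // j ≠ i} → W) × ({j : ι // j ≠ i} → W') → ENNReal},
      Measurable H →
      ∫⁻ ω, H (a (ω.1 i), fun j => ω.1 j, fun j => ω.2 j) ∂glue k c c' P Q =
      ∫⁻ z, ∫⁻ z', ((∏ j : {j : ι // j ≠ i}, k (c (z j)) (c' (z' j)) : NNReal) : ENNReal) *
        ∫⁻ x, H (x, fun j => z j, fun j => z' j) ∂μ ∂Q ∂P := by
    intro H hH
    set ρ : (({j : ι // j ≠ i} → W) × ({j : ι // j ≠ i} → W')) → ENNReal := fun w =>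
      ((∏ j : {j : ι // j ≠ i}, k (c (w.1 j)) (c' (w.2 j)) : NNReal) : ENNReal) with hρdef
    have hρ : Measurable ρ := (hk.measurable_prod hc hc' _).coe_nnreal_ennreal
    have hρι : Measurable fun ω : (ι → W) × (ι → W') =>
        ((∏ i, k (c (ω.1 i)) (c' (ω.2 i)) : NNReal) : ENNReal) :=
      (hk.measurable_prod hc hc' ι).coe_nnreal_ennreal
    have hkm : Measurable fun w : V × V => (k w.1 w.2 : ENNReal) :=
      hk.measurable.coe_nnreal_ennreal
    rw [lintegral_glue hk hc hc'
      (f := fun ω => H (a (ω.1 i), fun j => ω.1 j, fun j => ω.2 j)) (by fun_prop),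
      lintegral_prod (fun ω : (ι → W) × (ι → W') => _ *
        H (a (ω.1 i), fun j => ω.1 j, fun j => ω.2 j))
        (hρι.mul (by fun_prop)).aemeasurable]
    calc ∫⁻ z, ∫⁻ z', ((∏ i, k (c (z i)) (c' (z' i)) : NNReal) : ENNReal) *
          H (a (z i), fun j => z j, fun j => z' j) ∂Q ∂P
        = ∫⁻ z, ∫⁻ z', ρ (fun j => z j, fun j => z' j) *
          H (a (z i), fun j => z j, fun j => z' j) ∂Q ∂P := by
          refine lintegral_congr_ae ?_
          filter_upwards [hP.ae_eval hc i hk.left] with z hz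
          have hkz : Measurable fun y => (k (c (z i)) y : ENNReal) :=
            hkm.comp measurable_prodMk_left
          have h1 := hQ.lintegral_eq hc' i (H := fun w => (k (c (z i)) w.1 : ENNReal) *
            (ρ (fun j => z j, w.2) * H (a (z i), fun j => z j, w.2)))
            ((hkz.comp measurable_fst).mul (by fun_prop))
          simp only [lintegral_mul_const _ hkz, hz, one_mul] at h1
          rw [← h1]
          refine lintegral_congr fun z' => ?_
          rw [Fintype.prod_eq_mul_prod_subtype_ne _ i, ENNReal.coe_mul, mul_assoc]
      _ = ∫⁻ z, ∫⁻ x, ∫⁻ z', ρ (fun j => z j, fun j => z' j) *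
          H (x, fun j => z j, fun j => z' j) ∂Q ∂μ ∂P :=
          hPa.lintegral_eq ha i (H := fun w => ∫⁻ z', ρ (w.2, fun j => z' j) *
            H (w.1, w.2, fun j => z' j) ∂Q)
            (Measurable.lintegral_prod_right' (f := fun w : (A × ({j : ι // j ≠ i} → W)) ×
              (ι → W') => ρ (w.1.2, fun j => w.2 j) * H (w.1.1, w.1.2, fun j => w.2 j))
              (by fun_prop))
      _ = _ := by
          refine lintegral_congr fun z => ?_
          rw [lintegral_lintegral_swap
            (Measurable.aemeasurable (by unfold Function.uncurry; fun_prop))]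
          refine lintegral_congr fun z' => ?_
          rw [lintegral_const_mul _ (by fun_prop)]
  rw [key hH]
  have hH' : Measurable fun w : ({j : ι // j ≠ i} → W) × ({j : ι // j ≠ i} → W') =>
      ∫⁻ x, H (x, w) ∂μ := hH.lintegral_prod_left'
  have h2 := key (H := fun w => ∫⁻ x, H (x, w.2) ∂μ) (hH'.comp measurable_snd)
  simp only [lintegral_const, measure_univ, mul_one] at h2
  rw [h2]

lemma isMar_map_glue {A B : Type*} [MeasurableSpace A] [MeasurableSpace B] {μ : Measure A}
    [IsProbabilityMeasure μ] {a : W → A} {b : W' → B} (hk : IsBistochastic ν k)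
    (hc : Measurable c) (hc' : Measurable c') (ha : Measurable a) (hb : Measurable b)
    (hP : IsMar c ν P) (hPa : IsMar a μ P) (hQ : IsMar c' ν Q) :
    IsMar Prod.fst μ ((glue k c c' P Q).map fun ω i => (a (ω.1 i), b (ω.2 i))) := by
  intro i
  have := isProbabilityMeasure_glue hk hc hc' hP hQ
  rw [Measure.map_map (by fun_prop) (by fun_prop), Measure.map_map (by fun_prop) (by fun_prop)]
  refine Measure.ext_of_lintegral _ fun f hf => ?_
  rw [lintegral_map hf (by fun_prop), lintegral_prod_symm _ hf.aemeasurable,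
    lintegral_map hf.lintegral_prod_left' (by fun_prop)]
  exact lintegral_glue_of_isMar hk hc hc' ha hP hPa hQ i
    (H := fun w => f (w.1, fun j => (a (w.2.1 j), b (w.2.2 j)))) (hf.comp (by fun_prop))

end glue

lemma PSDCond.isPosForm [MeasurableSpace X] [MeasurableSpace Y] {r : ℕ}
    {P : Measure (Fin (2 * r) → X × Y)} (hP : PSDCond r P) {t : ℕ} (ht : t ≤ r) :
    IsPosForm P (fun z s => z (blockEquiv r t ht (.inl s)))
      (fun z s => z (blockEquiv r t ht (.inr (.inl s))))
      (fun z s => z (blockEquiv r t ht (.inr (.inr s)))) :=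
  fun f g => hP t ht f g

lemma SymCond.map_blocks [MeasurableSpace X] [MeasurableSpace Y] {r : ℕ}
    {P : Measure (Fin (2 * r) → X × Y)} (hP : SymCond r P) {t : ℕ} (ht : t ≤ r) :
    P.map (fun z => ((fun s => z (blockEquiv r t ht (.inl s)) : Fin t → X × Y),
      (fun s => z (blockEquiv r t ht (.inr (.inl s))) : Fin t → X × Y),
      fun s => z (blockEquiv r t ht (.inr (.inr s))))) =
    P.map (fun z => ((fun s => z (blockEquiv r t ht (.inr (.inl s))) : Fin t → X × Y),
      (fun s => z (blockEquiv r t ht (.inl s)) : Fin t → X × Y),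
      fun s => z (blockEquiv r t ht (.inr (.inr s))))) := by
  set e : Equiv.Perm (Fin t ⊕ (Fin t ⊕ Fin (2 * r - 2 * t))) :=
    (Equiv.sumAssoc _ _ _).symm.trans
      (((Equiv.sumComm _ _).sumCongr (Equiv.refl _)).trans (Equiv.sumAssoc _ _ _))
  conv_lhs => rw [← hP ((blockEquiv r t ht).permCongr e)]
  rw [Measure.map_map (by fun_prop) (by fun_prop)]
  congr 1
  ext z s <;> simp [Equiv.permCongr_apply, e]

section gluePSD

variable {Z : Type*} [MetricSpace X] [SecondCountableTopology X] [MeasurableSpace X] [BorelSpace X]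
  [MetricSpace Y] [SecondCountableTopology Y] [MeasurableSpace Y] [BorelSpace Y]
  [MetricSpace Z] [SecondCountableTopology Z] [MeasurableSpace Z] [BorelSpace Z]
  {r : ℕ} {ν : Measure Y} {k : Y → Y → NNReal}
  {P : Measure (Fin (2 * r) → X × Y)} {Q : Measure (Fin (2 * r) → Y × Z)}

lemma psdCond_map_glue [IsProbabilityMeasure P] [IsProbabilityMeasure Q]
    (hk : IsBistochastic ν k) (hP : PSDCond r P) (hQ : PSDCond r Q) (hQs : SymCond r Q) :
    PSDCond r ((glue k Prod.snd Prod.fst P Q).map fun ω i => ((ω.1 i).1, (ω.2 i).2)) := by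
  intro t ht f g hf ⟨Mf, hMf⟩ hg ⟨Mg, hMg⟩ hg0
  obtain ⟨Mk, hMk⟩ := hk.bounded
  have hρ : ∀ (ι : Type) [Fintype ι], Measurable fun w : (ι → X × Y) × (ι → Y × Z) =>
      ((∏ i, k (w.1 i).2 (w.2 i).1 : NNReal) : ℝ) := fun ι _ =>
    (hk.measurable_prod measurable_snd measurable_fst ι).coe_nnreal_real
  have hρM : ∀ (ι : Type) [Fintype ι] (w : (ι → X × Y) × (ι → Y × Z)),
      |((∏ i, k (w.1 i).2 (w.2 i).1 : NNReal) : ℝ)| ≤ (Mk : ℝ) ^ Fintype.card ι := by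
    intro ι _ w
    rw [NNReal.abs_eq]
    exact_mod_cast (Finset.prod_le_pow_card _ _ _ fun i _ => hMk _ _)
  have hmain := (hP.isPosForm ht).prod (by fun_prop) (by fun_prop) (by fun_prop)
    (by fun_prop) (by fun_prop) (by fun_prop) (hQ.isPosForm ht) (hQs.map_blocks ht)
    (fun w => ((∏ i, k (w.1 i).2 (w.2 i).1 : NNReal) : ℝ) *
      f fun i => ((w.1 i).1, (w.2 i).2))
    (fun w => ((∏ i, k (w.1 i).2 (w.2 i).1 : NNReal) : ℝ) *
      g fun i => ((w.1 i).1, (w.2 i).2))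
    ((hρ _).mul (by fun_prop))
    ⟨(Mk : ℝ) ^ Fintype.card (Fin t) * Mf, fun w => by
      rw [abs_mul]
      exact mul_le_mul (hρM _ w) (hMf _) (abs_nonneg _) (by positivity)⟩
    ((hρ _).mul (by fun_prop))
    ⟨(Mk : ℝ) ^ Fintype.card (Fin (2 * r - 2 * t)) * Mg, fun w => by
      rw [abs_mul]
      exact mul_le_mul (hρM _ w) (hMg _) (abs_nonneg _) (by positivity)⟩
    (fun w => mul_nonneg (NNReal.coe_nonneg _) (hg0 _))
  rw [integral_map (by fun_prop) (by fun_prop), glue, integral_withDensity_eq_integral_smul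
    (hk.measurable_prod measurable_snd measurable_fst _)]
  refine hmain.trans_eq (integral_congr_ae (Eventually.of_forall fun ω => ?_))
  simp only
  rw [← Equiv.prod_comp (blockEquiv r t ht), Fintype.prod_sum_type, Fintype.prod_sum_type,
    NNReal.smul_def, smul_eq_mul, NNReal.coe_mul, NNReal.coe_mul]
  have hblock : ∀ a b c A B C : ℝ, a * A * (b * B) * (c * C) = a * (b * c) * (A * B * C) :=
    fun a b c A B C => by ring
  exact hblock _ _ _ _ _ _

lemma map_glue_mem_PiRSet {μ : Measure X} [IsProbabilityMeasure μ] [IsProbabilityMeasure ν]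
    {κ : Measure Z} [IsProbabilityMeasure κ] (hk : IsBistochastic ν k)
    (hP : P ∈ PiRSet r μ ν) (hQ : Q ∈ PiRSet r ν κ) :
    (glue k Prod.snd Prod.fst P Q).map (fun ω i => ((ω.1 i).1, (ω.2 i).2)) ∈ PiRSet r μ κ := by
  obtain ⟨hPprob, hPs, hPm, hPp⟩ := hP
  obtain ⟨hQprob, hQs, hQm, hQp⟩ := hQ
  rw [marCond_iff] at hPm hQm
  have hprob := isProbabilityMeasure_glue hk measurable_snd measurable_fst hPm.2 hQm.1
  refine ⟨Measure.isProbabilityMeasure_map (by fun_prop), fun σ => ?_, marCond_iff.2 ⟨?_, ?_⟩,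
    psdCond_map_glue hk hPp hQp hQs⟩
  · have h := map_glue_perm hk measurable_snd measurable_fst σ (hPs σ) (hQs σ)
    conv_rhs => rw [← h]
    rw [Measure.map_map (by fun_prop) (by fun_prop), Measure.map_map (by fun_prop) (by fun_prop)]
    rfl
  · exact isMar_map_glue hk measurable_snd measurable_fst measurable_fst measurable_snd
      hPm.2 hPm.1 hQm.1
  · have hprob' := isProbabilityMeasure_glue hk.flip measurable_fst measurable_snd hQm.1 hPm.2
    have h := isMar_map_glue hk.flip measurable_fst measurable_snd measurable_snd measurable_fst
      hQm.1 hQm.2 hPm.2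
    rw [← glue_map_swap hk measurable_snd measurable_fst,
      Measure.map_map (by fun_prop) (by fun_prop)] at h
    have : IsProbabilityMeasure ((glue k Prod.snd Prod.fst P Q).map
        ((fun (ω : (Fin (2 * r) → Y × Z) × (Fin (2 * r) → X × Y)) i =>
          ((ω.1 i).2, (ω.2 i).1)) ∘ Prod.swap)) :=
      Measure.isProbabilityMeasure_map (by fun_prop)
    have h2 := isMar_map_swap measurable_fst h
    rw [Measure.map_map (by fun_prop) (by fun_prop)] at h2
    exact h2

end gluePSD

lemma exists_simpleFunc_dist_lt {V : Type*} [MetricSpace V] [CompactSpace V] [MeasurableSpace V]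
    [BorelSpace V] [Nonempty V] {δ : ℝ} (hδ : 0 < δ) :
    ∃ s : SimpleFunc V V, ∀ y, dist (s y) y < δ := by
  set e := TopologicalSpace.denseSeq V
  obtain ⟨N, hN⟩ := isCompact_univ.elim_directed_cover (fun N : ℕ => ⋃ n ≤ N, ball (e n) δ)
    (fun N => isOpen_biUnion fun n _ => isOpen_ball)
    (fun y _ => by
      obtain ⟨n, hn⟩ := (TopologicalSpace.denseRange_denseSeq V).exists_dist_lt y hδ
      exact mem_iUnion.2 ⟨n, mem_iUnion₂.2 ⟨n, le_rfl, hn⟩⟩)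
    (directed_of_isDirected_le fun a b hab => iUnion₂_mono' fun n hn =>
      ⟨n, hn.trans hab, subset_rfl⟩)
  refine ⟨SimpleFunc.nearestPt e N, fun y => ?_⟩
  obtain ⟨n, hn, hy⟩ := mem_iUnion₂.1 (hN (mem_univ y))
  rw [mem_ball'] at hy
  refine lt_of_le_of_lt ?_ hy
  have h := SimpleFunc.edist_nearestPt_le e y hn
  rwa [edist_dist, edist_dist, ENNReal.ofReal_le_ofReal_iff dist_nonneg] at h

lemma SimpleFunc.ae_measure_fiber_ne_zero {V : Type*} [MeasurableSpace V] (ν : Measure V)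
    (s : SimpleFunc V V) : ∀ᵐ y ∂ν, ν (s ⁻¹' {s y}) ≠ 0 := by
  have h : ∀ a ∈ s.range, ∀ᵐ y ∂ν, s y = a → ν (s ⁻¹' {a}) ≠ 0 := by
    intro a _
    by_cases ha : ν (s ⁻¹' {a}) = 0
    · filter_upwards [measure_eq_zero_iff_ae_notMem.1 ha] with y hy hya
      exact absurd hya hy
    · exact Eventually.of_forall fun _ _ => ha
  filter_upwards [(Filter.eventually_all_finset _).2 h] with y hy
  exact hy _ (s.mem_range_self y) rfl

lemma exists_isBistochastic {V : Type*} [MetricSpace V] [CompactSpace V] [MeasurableSpace V]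
    [BorelSpace V] (ν : Measure V) [IsProbabilityMeasure ν] {δ : ℝ} (hδ : 0 < δ) :
    ∃ k, IsBistochastic ν k ∧ ∀ y y', k y y' ≠ 0 → dist y y' < δ := by
  classical
  have : Nonempty V := nonempty_of_isProbabilityMeasure ν
  obtain ⟨s, hs⟩ := exists_simpleFunc_dist_lt (V := V) (half_pos hδ)
  set φ : V × V → NNReal := fun w => if w.1 = w.2 then (ν (s ⁻¹' {w.1})).toNNReal⁻¹ else 0
    with hφ
  set K : SimpleFunc (V × V) NNReal :=
    ((s.comp Prod.fst measurable_fst).pair (s.comp Prod.snd measurable_snd)).map φ with hK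
  have hsymm : ∀ y y', φ (s y, s y') = φ (s y', s y) := by
    intro y y'
    simp only [hφ]
    by_cases h : s y = s y'
    · rw [h]
    · rw [if_neg h, if_neg (Ne.symm h)]
  have hleft : ∀ᵐ y ∂ν, ∫⁻ y', φ (s y, s y') ∂ν = 1 := by
    filter_upwards [SimpleFunc.ae_measure_fiber_ne_zero ν s] with y hy
    have hind : ∀ y', (φ (s y, s y') : ENNReal) =
        (s ⁻¹' {s y}).indicator (fun _ => (ν (s ⁻¹' {s y}))⁻¹) y' := by
      intro y'
      by_cases h : s y' = s y
      · rw [indicator_of_mem (by simpa using h)]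
        simp only [hφ, h, if_true]
        rw [ENNReal.coe_inv, ENNReal.coe_toNNReal (measure_ne_top _ _)]
        exact (ENNReal.toNNReal_ne_zero).2 ⟨hy, measure_ne_top _ _⟩
      · rw [indicator_of_notMem (by simpa using h)]
        simp [hφ, Ne.symm h]
    simp only [hind]
    rw [lintegral_indicator_const (s.measurableSet_fiber _)]
    exact ENNReal.inv_mul_cancel hy (measure_ne_top _ _)
  refine ⟨fun y y' => φ (s y, s y'), ⟨K.measurable, ?_, hleft, ?_⟩, fun y y' h => ?_⟩
  · obtain ⟨C, hC⟩ := K.exists_forall_le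
    exact ⟨C, fun y y' => hC (y, y')⟩
  · filter_upwards [hleft] with y hy
    simpa only [hsymm] using hy
  · have hss : s y = s y' := by
      by_contra hne
      exact h (if_neg hne)
    have h1 := hs y
    have h2 := hs y'
    rw [dist_comm] at h1
    calc dist y y' ≤ dist y (s y) + dist (s y) y' := dist_triangle _ _ _
      _ < δ / 2 + δ / 2 := by
        rw [hss] at h1 ⊢
        exact add_lt_add h1 h2
      _ = δ := by ring

lemma exists_dist_rpow_close {V : Type*} [MetricSpace V] [CompactSpace V] {q η : ℝ}
    (hq : 0 ≤ q) (hη : 0 < η) : ∃ δ > 0, ∀ y₁ y₂ y₁' y₂' : V, dist y₁ y₁' < δ → dist y₂ y₂' < δ →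
      |dist y₁ y₂ ^ q - dist y₁' y₂' ^ q| ≤ η := by
  have hc : Continuous fun w : V × V => dist w.1 w.2 ^ q :=
    continuous_dist.rpow_const fun _ => Or.inr hq
  obtain ⟨δ, hδ, h⟩ := Metric.uniformContinuous_iff.1
    (CompactSpace.uniformContinuous_of_continuous hc) η hη
  refine ⟨δ, hδ, fun y₁ y₂ y₁' y₂' h1 h2 => ?_⟩
  have := h (a := (y₁, y₂)) (b := (y₁', y₂')) (by rw [Prod.dist_eq]; exact max_lt h1 h2)
  exact this.le

lemma dist_rpow_mem_Icc {V : Type*} [MetricSpace V] [CompactSpace V]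
    (hd : Metric.diam (Set.univ : Set V) ≤ 1) {q : ℝ} (hq : 0 ≤ q) (y y' : V) :
    dist y y' ^ q ∈ Icc (0 : ℝ) 1 :=
  ⟨Real.rpow_nonneg dist_nonneg _, Real.rpow_le_one dist_nonneg
    ((dist_le_diam_of_mem isCompact_univ.isBounded (mem_univ _) (mem_univ _)).trans hd) hq⟩

lemma measurable_distCost [MetricSpace X] [SecondCountableTopology X] [MeasurableSpace X]
    [BorelSpace X] [MetricSpace Y] [SecondCountableTopology Y] [MeasurableSpace Y] [BorelSpace Y]
    {p q : ℝ} {ι : Type*} (i j : ι) :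
    Measurable fun z : ι → X × Y => distCost p q (z i) (z j) := by
  unfold distCost
  fun_prop

lemma rpow_integral_add_add_le {Ω : Type*} [MeasurableSpace Ω] (T : Measure Ω)
    [IsProbabilityMeasure T] {f₁ f₂ f₃ : Ω → ℝ} {p η : ℝ} (hp : 1 ≤ p) (hη : 0 ≤ η)
    (hf₁ : Measurable f₁) (hf₂ : Measurable f₂) (hf₃ : Measurable f₃)
    (hb₁ : ∀ ω, |f₁ ω| ≤ 1) (hb₂ : ∀ᵐ ω ∂T, |f₂ ω| ≤ η) :
    (∫ ω, |f₁ ω + f₂ ω + f₃ ω| ^ p ∂T) ^ (1 / p) ≤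
      (∫ ω, |f₁ ω| ^ p ∂T) ^ (1 / p) + η + (∫ ω, |f₃ ω| ^ p ∂T) ^ (1 / p) := by
  have hp0 : 0 < p := by linarith
  have hlp : ∀ {f : Ω → ℝ}, Measurable f →
      lpNorm f (ENNReal.ofReal p) T = (∫ ω, |f ω| ^ p ∂T) ^ (1 / p) := by
    intro f hf
    rw [lpNorm_eq_integral_norm_rpow_toReal (by simpa using hp0) ENNReal.ofReal_ne_top
      hf.aestronglyMeasurable, ENNReal.toReal_ofReal hp0.le, one_div]
    rfl
  have hm : ∀ {f : Ω → ℝ} {C : ℝ}, Measurable f → (∀ᵐ ω ∂T, |f ω| ≤ C) →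
      MemLp f (ENNReal.ofReal p) T := fun hf hC => MemLp.of_bound hf.aestronglyMeasurable _ hC
  have hm₁ := hm hf₁ (Eventually.of_forall hb₁)
  have hm₂ := hm hf₂ hb₂
  have hp1 : 1 ≤ ENNReal.ofReal p := by simpa using ENNReal.ofReal_le_ofReal hp
  have h₂ : lpNorm f₂ (ENNReal.ofReal p) T ≤ η := by
    rw [hlp hf₂, one_div, Real.rpow_inv_le_iff_of_pos (by positivity) hη hp0]
    calc ∫ ω, |f₂ ω| ^ p ∂T ≤ ∫ _, η ^ p ∂T := by
          refine integral_mono_of_nonneg (Eventually.of_forall fun _ => by positivity)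
            (integrable_const _) ?_
          filter_upwards [hb₂] with ω hω
          exact Real.rpow_le_rpow (abs_nonneg _) hω hp0.le
      _ = η ^ p := by simp
  calc (∫ ω, |f₁ ω + f₂ ω + f₃ ω| ^ p ∂T) ^ (1 / p)
      = lpNorm (f₁ + f₂ + f₃) (ENNReal.ofReal p) T := (hlp ((hf₁.add hf₂).add hf₃)).symm
    _ ≤ lpNorm (f₁ + f₂) (ENNReal.ofReal p) T + lpNorm f₃ (ENNReal.ofReal p) T :=
        lpNorm_add_le (hm₁.add hm₂) hp1
    _ ≤ lpNorm f₁ (ENNReal.ofReal p) T + lpNorm f₂ (ENNReal.ofReal p) T +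
        lpNorm f₃ (ENNReal.ofReal p) T := by
        gcongr
        exact lpNorm_add_le hm₁ hp1
    _ ≤ _ := by
        rw [hlp hf₁, hlp hf₃]
        gcongr

section triangle

variable {Z : Type*}
  [MetricSpace X] [CompactSpace X] [MeasurableSpace X] [BorelSpace X]
  [MetricSpace Y] [CompactSpace Y] [MeasurableSpace Y] [BorelSpace Y]
  [MetricSpace Z] [CompactSpace Z] [MeasurableSpace Z] [BorelSpace Z]

lemma exists_mem_PiRSet_triangle (hdX : Metric.diam (Set.univ : Set X) ≤ 1)
    (hdY : Metric.diam (Set.univ : Set Y) ≤ 1)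
    {μ : Measure X} {ν : Measure Y} {κ : Measure Z}
    [IsProbabilityMeasure μ] [IsProbabilityMeasure ν] [IsProbabilityMeasure κ]
    {p q : ℝ} (hp : 1 ≤ p) (hq : 0 ≤ q) {r : ℕ} (i j : Fin (2 * r))
    {P : Measure (Fin (2 * r) → X × Y)} {Q : Measure (Fin (2 * r) → Y × Z)}
    (hP : P ∈ PiRSet r μ ν) (hQ : Q ∈ PiRSet r ν κ) {η : ℝ} (hη : 0 < η) :
    ∃ S ∈ PiRSet r μ κ, (∫ z, distCost p q (z i) (z j) ∂S) ^ (1 / p) ≤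
      (∫ z, distCost p q (z i) (z j) ∂P) ^ (1 / p) + η +
        (∫ z, distCost p q (z i) (z j) ∂Q) ^ (1 / p) := by
  obtain ⟨δ, hδ, hclose⟩ := exists_dist_rpow_close (V := Y) hq hη
  obtain ⟨k, hk, hkδ⟩ := exists_isBistochastic ν hδ
  refine ⟨_, map_glue_mem_PiRSet hk hP hQ, ?_⟩
  obtain ⟨hPprob, -, hPm, -⟩ := hP
  obtain ⟨hQprob, -, hQm, -⟩ := hQ
  rw [marCond_iff] at hPm hQm
  have hprob := isProbabilityMeasure_glue hk measurable_snd measurable_fst hPm.2 hQm.1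
  have hfst := glue_map_fst hk measurable_snd measurable_fst hPm.2 hQm.1
  have hsnd := glue_map_snd hk measurable_snd measurable_fst hPm.2 hQm.1
  have hae : ∀ᵐ ω ∂glue k Prod.snd Prod.fst P Q, ∀ l, dist (ω.1 l).2 (ω.2 l).1 < δ := by
    rw [glue, ae_withDensity_iff
      (hk.measurable_prod measurable_snd measurable_fst _).coe_nnreal_ennreal]
    refine Eventually.of_forall fun ω hω l => hkδ _ _ fun h0 => hω ?_
    rw [Finset.prod_eq_zero (Finset.mem_univ l) h0, ENNReal.coe_zero]
  set T := glue k Prod.snd Prod.fst P Q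
  have hdiff : ∀ {a b : ℝ}, a ∈ Icc (0 : ℝ) 1 → b ∈ Icc (0 : ℝ) 1 → |a - b| ≤ 1 :=
    fun ha hb => abs_le.2 ⟨by linarith [ha.1, hb.2], by linarith [ha.2, hb.1]⟩
  have hmain := rpow_integral_add_add_le T hp hη.le
    (f₁ := fun ω => dist (ω.1 i).1 (ω.1 j).1 ^ q - dist (ω.1 i).2 (ω.1 j).2 ^ q)
    (f₂ := fun ω => dist (ω.1 i).2 (ω.1 j).2 ^ q - dist (ω.2 i).1 (ω.2 j).1 ^ q)
    (f₃ := fun ω => dist (ω.2 i).1 (ω.2 j).1 ^ q - dist (ω.2 i).2 (ω.2 j).2 ^ q)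
    (by fun_prop) (by fun_prop) (by fun_prop)
    (fun ω => hdiff (dist_rpow_mem_Icc hdX hq _ _) (dist_rpow_mem_Icc hdY hq _ _))
    (hae.mono fun ω hω => hclose _ _ _ _ (hω i) (hω j))
  have hPint : ∫ z, distCost p q (z i) (z j) ∂P =
      ∫ ω, |dist (ω.1 i).1 (ω.1 j).1 ^ q - dist (ω.1 i).2 (ω.1 j).2 ^ q| ^ p ∂T := by
    conv_lhs => rw [← hfst]
    exact integral_map (by fun_prop) (measurable_distCost _ _).aestronglyMeasurable
  have hQint : ∫ z, distCost p q (z i) (z j) ∂Q =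
      ∫ ω, |dist (ω.2 i).1 (ω.2 j).1 ^ q - dist (ω.2 i).2 (ω.2 j).2 ^ q| ^ p ∂T := by
    conv_lhs => rw [← hsnd]
    exact integral_map (by fun_prop) (measurable_distCost _ _).aestronglyMeasurable
  rw [hPint, hQint, integral_map (by fun_prop) (measurable_distCost _ _).aestronglyMeasurable]
  simpa only [distCost, sub_add_sub_cancel] using hmain

end triangle

lemma nonempty_PiRSet [MeasurableSpace X] [MeasurableSpace Y] (r : ℕ) (μ : Measure X)
    (ν : Measure Y) [IsProbabilityMeasure μ] [IsProbabilityMeasure ν] :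
    Nonempty (PiRSet r μ ν) := by
  have h := pi_mem_PiRSet r (μ.prod ν)
  rw [Measure.map_fst_prod, Measure.map_snd_prod, measure_univ, measure_univ, one_smul,
    one_smul] at h
  exact ⟨_, h⟩

section gwRVal

variable [MetricSpace X] [MetricSpace Y]

lemma distCost_nonneg {p q : ℝ} (z w : X × Y) : 0 ≤ distCost p q z w :=
  Real.rpow_nonneg (abs_nonneg _) _

lemma distCost_swap {p q : ℝ} (z w : X × Y) : distCost p q z.swap w.swap = distCost p q z w := by
  simp only [distCost, Prod.fst_swap, Prod.snd_swap, abs_sub_comm]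

variable [MeasurableSpace X] [MeasurableSpace Y]

lemma gwRVal_nonneg {p q : ℝ} {r : ℕ} (hr : 0 < r) (μ : Measure X) (ν : Measure Y) :
    0 ≤ gwRVal r hr (distCost p q) μ ν :=
  Real.iInf_nonneg fun _ => integral_nonneg fun _ => distCost_nonneg _ _

lemma gwRVal_le {p q : ℝ} {r : ℕ} (hr : 0 < r) {μ : Measure X} {ν : Measure Y}
    {P : Measure (Fin (2 * r) → X × Y)} (hP : P ∈ PiRSet r μ ν) :
    gwRVal r hr (distCost p q) μ ν ≤
      ∫ z, distCost p q (z ⟨0, by omega⟩) (z ⟨1, by omega⟩) ∂P :=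
  ciInf_le (f := fun P : PiRSet r μ ν =>
      ∫ z, distCost p q (z ⟨0, by omega⟩) (z ⟨1, by omega⟩) ∂(P : Measure (Fin (2 * r) → X × Y)))
    ⟨0, by
      rintro _ ⟨P, rfl⟩
      exact integral_nonneg fun _ => distCost_nonneg _ _⟩ ⟨P, hP⟩

lemma gwRVal_comm_le [SecondCountableTopology X] [BorelSpace X] [SecondCountableTopology Y]
    [BorelSpace Y] {p q : ℝ} {r : ℕ} (hr : 0 < r) (μ : Measure X) (ν : Measure Y)
    [IsProbabilityMeasure μ] [IsProbabilityMeasure ν] :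
    gwRVal r hr (distCost p q) ν μ ≤ gwRVal r hr (distCost p q) μ ν := by
  have := nonempty_PiRSet r μ ν
  refine le_ciInf fun P => (gwRVal_le hr (swap_mem_PiRSet P.2)).trans_eq ?_
  have hm : Measurable fun (z : Fin (2 * r) → X × Y) i => (z i).swap := by fun_prop
  rw [integral_map hm.aemeasurable (measurable_distCost _ _).aestronglyMeasurable]
  simp only [distCost_swap]

lemma gwRVal_self [SecondCountableTopology X] [BorelSpace X] {p q : ℝ} (hp : p ≠ 0) {r : ℕ}
    (hr : 0 < r) (μ : Measure X) [IsProbabilityMeasure μ] :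
    gwRVal r hr (distCost p q) μ μ = 0 := by
  have hdiag : Measurable fun x : X => (x, x) := by fun_prop
  have : IsProbabilityMeasure (μ.map fun x => (x, x)) :=
    Measure.isProbabilityMeasure_map hdiag.aemeasurable
  have h := pi_mem_PiRSet r (μ.map fun x => (x, x))
  have hid : ∀ {f : X × X → X}, Measurable f → (∀ x, f (x, x) = x) →
      (μ.map fun x => (x, x)).map f = μ := by
    intro f hf hfx
    rw [Measure.map_map hf hdiag, show f ∘ (fun x => (x, x)) = id from funext hfx, Measure.map_id]
  rw [hid measurable_fst fun _ => rfl, hid measurable_snd fun _ => rfl] at h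
  refine le_antisymm ((gwRVal_le hr h).trans_eq ?_) (gwRVal_nonneg hr μ μ)
  refine integral_eq_zero_of_ae ?_
  have hae : ∀ᵐ w ∂(μ.map fun x => (x, x)), w.1 = w.2 := by
    rw [ae_map_iff hdiag.aemeasurable (measurableSet_eq_fun measurable_fst measurable_snd)]
    exact Eventually.of_forall fun _ => rfl
  have heval : ∀ i : Fin (2 * r), ∀ᵐ z ∂(Measure.pi fun _ : Fin (2 * r) =>
      μ.map fun x => (x, x)), (z i).1 = (z i).2 := fun i =>
    (measurePreserving_eval (fun _ : Fin (2 * r) => μ.map fun x => (x, x)) i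
      ).quasiMeasurePreserving.ae hae
  filter_upwards [heval ⟨0, by omega⟩, heval ⟨1, by omega⟩] with z h0 h1
  simp [distCost, h0, h1, Real.zero_rpow hp]

lemma exists_rpow_integral_lt_gwRVal_add {p q : ℝ} (hp : 0 < p) {r : ℕ} (hr : 0 < r)
    (μ : Measure X) (ν : Measure Y) [IsProbabilityMeasure μ] [IsProbabilityMeasure ν] {η : ℝ}
    (hη : 0 < η) : ∃ P ∈ PiRSet r μ ν,
      (∫ z, distCost p q (z ⟨0, by omega⟩) (z ⟨1, by omega⟩) ∂P) ^ (1 / p) <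
        gwRVal r hr (distCost p q) μ ν ^ (1 / p) + η := by
  have := nonempty_PiRSet r μ ν
  have h0 := gwRVal_nonneg (p := p) (q := q) hr μ ν
  have hroot : 0 ≤ gwRVal r hr (distCost p q) μ ν ^ (1 / p) := Real.rpow_nonneg h0 _
  have hlt : gwRVal r hr (distCost p q) μ ν <
      (gwRVal r hr (distCost p q) μ ν ^ (1 / p) + η) ^ p := by
    rw [← Real.rpow_inv_lt_iff_of_pos h0 (by positivity) hp]
    rw [← one_div]
    linarith
  obtain ⟨P, hP⟩ := exists_lt_of_ciInf_lt hlt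
  refine ⟨P, P.2, ?_⟩
  rw [one_div] at hP ⊢
  exact (Real.rpow_inv_lt_iff_of_pos (integral_nonneg fun _ => distCost_nonneg _ _)
    (by positivity) hp).2 hP

end gwRVal

end

theorem stmt11 {X Y Z : Type*}
    [MetricSpace X] [CompactSpace X] [PolishSpace X] [MeasurableSpace X] [BorelSpace X]
    [MetricSpace Y] [CompactSpace Y] [PolishSpace Y] [MeasurableSpace Y] [BorelSpace Y]
    [MetricSpace Z] [CompactSpace Z] [PolishSpace Z] [MeasurableSpace Z] [BorelSpace Z]
    (hdX : Metric.diam (Set.univ : Set X) ≤ 1) (hdY : Metric.diam (Set.univ : Set Y) ≤ 1)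
    (hdZ : Metric.diam (Set.univ : Set Z) ≤ 1)
    (μ : Measure X) (ν : Measure Y) (κ : Measure Z)
    [IsProbabilityMeasure μ] [IsProbabilityMeasure ν] [IsProbabilityMeasure κ]
    (p q : ℝ) (hp : 1 ≤ p) (hq : 1 ≤ q)
    (r : ℕ) (hr : 0 < r) :
    -- (1) vanishing on the diagonal
    (gwRVal r hr (distCost p q) μ μ) ^ (1 / p) = 0 ∧
    -- (2) non-negativity
    0 ≤ (gwRVal r hr (distCost p q) μ ν) ^ (1 / p) ∧
    -- (3) symmetry
    (gwRVal r hr (distCost p q) μ ν) ^ (1 / p)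
      = (gwRVal r hr (distCost p q) ν μ) ^ (1 / p) ∧
    -- (4) triangle inequality
    (gwRVal r hr (distCost p q) μ κ) ^ (1 / p)
      ≤ (gwRVal r hr (distCost p q) μ ν) ^ (1 / p)
        + (gwRVal r hr (distCost p q) ν κ) ^ (1 / p) := by
  have hp0 : 0 < p := by linarith
  refine ⟨?_, Real.rpow_nonneg (gwRVal_nonneg hr μ ν) _, ?_, ?_⟩
  · rw [gwRVal_self hp0.ne' hr μ, Real.zero_rpow (by positivity)]
  · rw [le_antisymm (gwRVal_comm_le hr ν μ) (gwRVal_comm_le hr μ ν)]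
  · refine le_of_forall_pos_le_add fun ε hε => ?_
    obtain ⟨P, hP, hPlt⟩ :=
      exists_rpow_integral_lt_gwRVal_add (q := q) hp0 hr μ ν (η := ε / 3) (by positivity)
    obtain ⟨Q, hQ, hQlt⟩ :=
      exists_rpow_integral_lt_gwRVal_add (q := q) hp0 hr ν κ (η := ε / 3) (by positivity)
    obtain ⟨S, hS, hSle⟩ := exists_mem_PiRSet_triangle hdX hdY hp (q := q) (by linarith)
      (⟨0, by omega⟩ : Fin (2 * r)) ⟨1, by omega⟩ hP hQ (η := ε / 3) (by positivity)
    have hgw := Real.rpow_le_rpow (gwRVal_nonneg hr μ κ) (gwRVal_le (p := p) (q := q) hr hS)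
      (by positivity : 0 ≤ 1 / p)
    linarith

end GWSOS
end

section
/- Suppose y ∈ M^{(r)}(μ,ν) is a feasible pseudo-moment sequence for (S-DGW-r2). Then the atomic measure P_y on (𝒳×𝒴)^{2r}, defined by P_y((x_{i₁},y_{j₁},…,x_{i_{2r}},y_{j_{2r}})) := ℓ_y(∏_{s=1}^{2r} π_{i_s j_s}), satisfies the positive-semidefiniteness condition (PSD): for every subset I = {(i*₁,j*₁),…,(i*_{2d_I},j*_{2d_I})} ⊆ [m]×[n] of even cardinality 2d_I ≤ 2r and every function f on (𝒳×𝒴)^{r−d_I}, one has Σ over all index tuples of f(z̄₁,…,z̄_{r−d_I}) f(z̄_{r−d_I+1},…,z̄_{2r−2d_I}) P_y((z̄₁,…,z̄_{2r−2d_I}, (x_{i*₁},y_{j*₁}),…,(x_{i*_{2d_I}},y_{j*_{2d_I}}))) ≥ 0, where z̄_s ranges over 𝒳×𝒴. -/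
namespace GWDiscrete

/-- Multi-indices over the `m × n` variables `π_{ij}`. -/
abbrev MIdx (m n : ℕ) := Fin m × Fin n → ℕ

/-- Total degree of a multi-index. -/
def degIdx {m n : ℕ} (α : MIdx m n) : ℕ := ∑ p : Fin m × Fin n, α p

/-- The multi-index of the single variable `π_{p0}`. -/
def unitIdx {m n : ℕ} (p0 : Fin m × Fin n) : MIdx m n :=
  fun p => if p = p0 then 1 else 0

/-- The multi-index of the monomial `e_I = ∏_{(i,j) ∈ I} π_{ij}`. -/
def eIdx {m n : ℕ} (I : Finset (Fin m × Fin n)) : MIdx m n :=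
  fun p => if p ∈ I then 1 else 0

/-- The feasible set `M^{(r)}(μ,ν)` of the Schmüdgen-type relaxation (S-DGW-r2),
described via pseudo-moment sequences `y`. -/
def MFeas {m n : ℕ} (r : ℕ) (μ : Fin m → ℝ) (ν : Fin n → ℝ)
    (y : MIdx m n → ℝ) : Prop :=
  -- y_0 = 1
  y (fun _ => 0) = 1 ∧
  -- the truncated localizing matrices M̄_{r-d_I}(e_I y) are PSD for |I| = 2 d_I ≤ 2r
  (∀ (I : Finset (Fin m × Fin n)) (d : ℕ), I.card = 2 * d → d ≤ r →
    ∀ F : MIdx m n →₀ ℝ, (∀ γ ∈ F.support, degIdx γ = r - d) →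
      0 ≤ ∑ γ ∈ F.support, ∑ τ ∈ F.support, F γ * F τ * y (γ + τ + eIdx I)) ∧
  -- the row marginal conditions M_{r-1}(r_i(π) y) = 0
  (∀ i : Fin m, ∀ α : MIdx m n, degIdx α ≤ 2 * r - 2 →
    (∑ j : Fin n, y (α + unitIdx (i, j))) = μ i * y α) ∧
  -- the column marginal conditions M_{r-1}(c_j(π) y) = 0
  (∀ j : Fin n, ∀ α : MIdx m n, degIdx α ≤ 2 * r - 2 →
    (∑ i : Fin m, y (α + unitIdx (i, j))) = ν j * y α)

/-- Exponent multi-index of the monomial `∏_s π_{w s}` determined by a tuple of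
coordinates `w`. -/
def expOf {m n N : ℕ} (w : Fin N → Fin m × Fin n) : MIdx m n :=
  fun p => ∑ s : Fin N, if w s = p then 1 else 0

/-- The atomic measure `P_y` on `(𝒳 × 𝒴)^{2r}` induced by the pseudo-moment
sequence `y`: mass `ℓ_y(∏_s π_{w s})` at the atom `w`. -/
def atomicPy {m n : ℕ} (r : ℕ) (y : MIdx m n → ℝ)
    (w : Fin (2 * r) → Fin m × Fin n) : ℝ :=
  y (expOf w)

/-- Prepend an element to a `(2r-1)`-tuple, producing a `2r`-tuple. -/
def consFn {Z : Type*} (r : ℕ) (z0 : Z) (rest : Fin (2 * r - 1) → Z) :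
    Fin (2 * r) → Z :=
  fun s => if h : s.1 = 0 then z0 else rest ⟨s.1 - 1, by have := s.isLt; omega⟩

/-- Append a fixed `2d`-tuple to a `(2r-2d)`-tuple, producing a `2r`-tuple. -/
def appFn {Z : Type*} (r d : ℕ) (w : Fin (2 * r - 2 * d) → Z) (tl : Fin (2 * d) → Z) :
    Fin (2 * r) → Z :=
  fun s => if h : s.1 < 2 * r - 2 * d then w ⟨s.1, h⟩
    else tl ⟨s.1 - (2 * r - 2 * d), by have := s.isLt; omega⟩

end GWDiscrete

namespace GWDiscrete

theorem expOf_eq_add {m n N a b : ℕ} (h : a + b = N) (w : Fin N → Fin m × Fin n) :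
    expOf w = expOf (fun s : Fin a => w ⟨s.1, by have := s.isLt; omega⟩)
      + expOf (fun s : Fin b => w ⟨a + s.1, by have := s.isLt; omega⟩) := by
  subst h
  ext p
  simp only [expOf, Pi.add_apply, Fin.sum_univ_add]
  rfl

theorem degIdx_expOf {m n N : ℕ} (w : Fin N → Fin m × Fin n) : degIdx (expOf w) = N := by
  simp only [degIdx, expOf]
  rw [Finset.sum_comm]
  simp

theorem expOf_eq_eIdx_image {m n N : ℕ} {e : Fin N → Fin m × Fin n}
    (he : Function.Injective e) : expOf e = eIdx (Finset.univ.image e) := by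
  ext p
  simp only [expOf, eIdx, Finset.mem_image, Finset.mem_univ, true_and]
  split_ifs with h
  · obtain ⟨s, rfl⟩ := h
    simp [he.eq_iff]
  · exact Finset.sum_eq_zero fun s _ => if_neg fun hs => h ⟨s, hs⟩

theorem expOf_appFn {m n r d : ℕ} (hd : d ≤ r) (w : Fin (2 * r - 2 * d) → Fin m × Fin n)
    (e : Fin (2 * d) → Fin m × Fin n) : expOf (appFn r d w e) = expOf w + expOf e := by
  rw [expOf_eq_add (a := 2 * r - 2 * d) (b := 2 * d) (by omega)]
  congr 2
  · ext1 s
    simp [appFn]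
  · ext1 s
    simp [appFn]

/-- Splitting a tuple into its two halves. -/
def splitEquiv (Z : Type*) {N k : ℕ} (h : N = k + k) :
    (Fin N → Z) ≃ (Fin k → Z) × (Fin k → Z) where
  toFun w := (fun s => w ⟨s.1, by have := s.isLt; omega⟩,
    fun s => w ⟨k + s.1, by have := s.isLt; omega⟩)
  invFun q s := if hs : s.1 < k then q.1 ⟨s.1, hs⟩
    else q.2 ⟨s.1 - k, by have := s.isLt; omega⟩
  left_inv w := by
    ext1 s
    by_cases hs : s.1 < k
    · simp [hs]
    · simp only [hs, dite_false]
      congr 2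
      omega
  right_inv q := by
    ext1 <;> ext1 s <;> simp

/-- A quadratic form evaluated at a pushforward `∑ u, f u • δ (g u)`. -/
theorem sum_support_sum_single {ι A : Type*} [Fintype ι] (g : ι → A) (f : ι → ℝ)
    (K : A → A → ℝ) :
    let F : A →₀ ℝ := ∑ u, Finsupp.single (g u) (f u)
    ∑ γ ∈ F.support, ∑ τ ∈ F.support, F γ * F τ * K γ τ
      = ∑ u, ∑ v, f u * f v * K (g u) (g v) := by
  intro F
  have key (h : A → ℝ) : ∑ γ ∈ F.support, F γ * h γ = ∑ u, f u * h (g u) := by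
    change F.sum (fun γ a => a * h γ) = _
    rw [← Finsupp.sum_finsetSum_index (by simp) (by intros; ring)]
    simp
  simp only [mul_assoc, ← Finset.mul_sum, key]

theorem stmt18 {m n : ℕ} (r : ℕ) (hr : 0 < r)
    (μ : Fin m → ℝ) (ν : Fin n → ℝ)
    (hμ0 : ∀ i, 0 ≤ μ i) (hν0 : ∀ j, 0 ≤ ν j)
    (hμ1 : ∑ i, μ i = 1) (hν1 : ∑ j, ν j = 1)
    (y : MIdx m n → ℝ) (hy : MFeas r μ ν y) :
    ∀ (d : ℕ) (hd : d ≤ r) (e : Fin (2 * d) → Fin m × Fin n),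
      Function.Injective e →
      ∀ f : (Fin (r - d) → Fin m × Fin n) → ℝ,
        0 ≤ ∑ w : Fin (2 * r - 2 * d) → Fin m × Fin n,
          f (fun s => w ⟨s.1, by have := s.isLt; omega⟩)
            * f (fun s => w ⟨(r - d) + s.1, by have := s.isLt; omega⟩)
            * atomicPy r y (appFn r d w e) := by
  intro d hd e he f
  have hcard : (Finset.univ.image e).card = 2 * d := by
    simp [Finset.card_image_of_injective _ he]
  have hpsd := hy.2.1 (Finset.univ.image e) d hcard hd (∑ u, Finsupp.single (expOf u) (f u))
    fun γ hγ => by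
      obtain ⟨u, -, hu⟩ := Finset.mem_biUnion.mp (Finsupp.support_finsetSum hγ)
      rw [Finset.mem_singleton.mp (Finsupp.support_single_subset hu), degIdx_expOf]
  rw [sum_support_sum_single expOf f (fun γ τ => y (γ + τ + eIdx (Finset.univ.image e))),
    ← Fintype.sum_prod_type'] at hpsd
  refine hpsd.trans_eq (Fintype.sum_equiv (splitEquiv _ (by omega)) _ _ fun w => ?_).symm
  rw [atomicPy, expOf_appFn hd, expOf_eq_eIdx_image he,
    expOf_eq_add (a := r - d) (b := r - d) (by omega) w]
  rfl

end GWDiscrete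
end
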